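/- arXiv:2503.05506 — 5 statements merged into one kernel-verified Lean document; each statement's English description precedes it below -/
import Mathlib

section
/- For every integer n ≥ 4, the wheel graph W_n of order n is edge-pancyclic and has exactly 2n − 2 edges. Consequently, for every n ≥ 4 there exists an edge-pancyclic graph of order n with at most 2n − 2 edges. -/
/-- The edge `e` lies in a cycle of length `k` in the graph `G`. -/
def SimpleGraph.EdgeInCycleOfLength {V : Type*} (G : SimpleGraph V) (e : Sym2 V) (k : ℕ) : Prop :=
  ∃ (v : V) (c : G.Walk v v), c.IsCycle ∧ c.length = k ∧ e ∈ c.edges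

/-- A graph `G` of order `n` is edge-pancyclic if for every `k` with `3 ≤ k ≤ n`,
every edge of `G` lies in a cycle of length `k`. -/
def SimpleGraph.EdgePancyclic {V : Type*} [Fintype V] (G : SimpleGraph V) : Prop :=
  ∀ k : ℕ, 3 ≤ k → k ≤ Fintype.card V → ∀ e ∈ G.edgeSet, G.EdgeInCycleOfLength e k

/-- A graph `G` is `k`-edge-proper if every edge of `G` lies in a cycle of length `i`
for every `3 ≤ i ≤ k`, and every edge of `G` lies in a Hamilton cycle of `G`. -/
def SimpleGraph.EdgeProper {V : Type*} [Fintype V] [DecidableEq V]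
    (G : SimpleGraph V) (k : ℕ) : Prop :=
  ∀ e ∈ G.edgeSet,
    (∀ i : ℕ, 3 ≤ i → i ≤ k → G.EdgeInCycleOfLength e i) ∧
    ∃ (v : V) (c : G.Walk v v), c.IsHamiltonianCycle ∧ e ∈ c.edges

/-- The wheel graph of order `n`: vertex `0` is the hub, joined to every vertex of the
cycle `1, 2, …, n-1` (which has edges `i — i+1` for `1 ≤ i ≤ n-2` and `1 — (n-1)`). -/
def wheelGraph (n : ℕ) : SimpleGraph (Fin n) :=
  SimpleGraph.fromRel (fun a b =>
    a.val = 0 ∨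
    (a.val ≠ 0 ∧ b.val ≠ 0 ∧ (a.val + 1 = b.val ∨ (a.val = 1 ∧ b.val = n - 1))))

/-- A sequence of consecutively adjacent vertices yields a walk. -/
theorem SimpleGraph.exists_walk_support_eq_map_range' {V : Type*} {G : SimpleGraph V}
    {f : ℕ → V} (hf : ∀ i, G.Adj (f i) (f (i + 1))) (s m : ℕ) :
    ∃ p : G.Walk (f s) (f (s + m)),
      p.length = m ∧ p.support = (List.range' s (m + 1)).map f := by
  induction m with
  | zero => exact ⟨.nil, by simp⟩
  | succ m ih =>
    obtain ⟨p, hp, hs⟩ := ih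
    refine ⟨p.concat (hf (s + m)), by simp [hp], ?_⟩
    rw [Walk.support_concat, hs, List.range'_concat (n := m + 1)]
    simp

/-- A vertex `c` adjacent to all of `f s, …, f (s + m + 1)` closes up the path through these
vertices to a cycle. -/
theorem SimpleGraph.exists_isCycle_of_adj {V : Type*} {G : SimpleGraph V} {f : ℕ → V} {c : V}
    (hf : ∀ i, G.Adj (f i) (f (i + 1))) (hc : ∀ i, G.Adj c (f i)) (s m : ℕ)
    (hinj : Set.InjOn f (Set.Icc s (s + m + 1))) :
    ∃ w : G.Walk c c, w.IsCycle ∧ w.length = m + 3 ∧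
      s(c, f s) ∈ w.edges ∧ s(f s, f (s + 1)) ∈ w.edges := by
  obtain ⟨p, hp, hs⟩ := exists_walk_support_eq_map_range' hf (s + 1) m
  have hpath : p.IsPath := by
    rw [Walk.isPath_def, hs]
    refine List.Nodup.map_on (fun x hx y hy h => hinj ?_ ?_ h) List.nodup_range' <;>
      simp only [List.mem_range'_1, Set.mem_Icc] at * <;> omega
  have hcp : c ∉ p.support := by
    rw [hs, List.mem_map]
    rintro ⟨i, -, rfl⟩
    exact (hc i).ne rfl
  have hsp : f s ∉ p.support := by
    rw [hs, List.mem_map]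
    rintro ⟨i, hi, h⟩
    rw [List.mem_range'_1] at hi
    have := hinj (by simp only [Set.mem_Icc]; omega) (by simp only [Set.mem_Icc]; omega) h
    omega
  have hsq : f s ∉ (p.concat (hc _).symm).support := by
    simp [Walk.support_concat, hsp, (hc s).ne']
  refine ⟨.cons (hc s) (.cons (hf s) (p.concat (hc _).symm)), ?_, by simp [hp], by simp, by simp⟩
  rw [Walk.cons_isCycle_iff, Walk.cons_isPath_iff]
  refine ⟨⟨hpath.concat hcp _, hsq⟩, fun h => ?_⟩
  rw [Walk.edges_cons, List.mem_cons] at h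
  rcases h with h | h
  · rw [Sym2.eq_iff] at h
    rcases h with h | h
    · exact (hc s).ne h.1
    · exact (hc (s + 1)).ne h.1
  · exact hsq (Walk.snd_mem_support_of_mem_edges _ h)

/-- The hub of the wheel graph. -/
def wheelHub {n : ℕ} (hn : 4 ≤ n) : Fin n := ⟨0, by omega⟩

/-- The rim vertices of the wheel graph, enumerated periodically. -/
def wheelRim {n : ℕ} (hn : 4 ≤ n) (i : ℕ) : Fin n :=
  ⟨i % (n - 1) + 1, by have := Nat.mod_lt i (y := n - 1) (by omega); omega⟩

theorem succ_mod_eq_ite {i k : ℕ} (hk : 2 ≤ k) :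
    (i + 1) % k = if i % k + 1 = k then 0 else i % k + 1 := by
  have hi := Nat.mod_lt i (y := k) (by omega)
  rw [Nat.add_mod, Nat.mod_eq_of_lt (a := 1) (by omega)]
  split_ifs with h
  · rw [h, Nat.mod_self]
  · exact Nat.mod_eq_of_lt (by omega)

theorem wheelGraph_adj_hub_rim {n : ℕ} (hn : 4 ≤ n) (i : ℕ) :
    (wheelGraph n).Adj (wheelHub hn) (wheelRim hn i) := by
  simp [wheelGraph, wheelHub, wheelRim]

theorem wheelGraph_adj_rim_succ {n : ℕ} (hn : 4 ≤ n) (i : ℕ) :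
    (wheelGraph n).Adj (wheelRim hn i) (wheelRim hn (i + 1)) := by
  have hi := Nat.mod_lt i (y := n - 1) (by omega)
  simp only [wheelGraph, wheelRim, SimpleGraph.fromRel_adj, ne_eq, Fin.mk.injEq,
    succ_mod_eq_ite (show 2 ≤ n - 1 by omega)]
  split_ifs <;> grind

theorem wheelRim_injOn {n : ℕ} (hn : 4 ≤ n) {s t : ℕ} (h : t < s + (n - 1)) :
    Set.InjOn (wheelRim hn) (Set.Icc s t) := by
  intro i hi j hj hij
  simp only [wheelRim, Fin.mk.injEq, Nat.add_right_cancel_iff] at hij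
  simp only [Set.mem_Icc] at hi hj
  rcases le_total i j with hle | hle
  · have := Nat.eq_zero_of_dvd_of_lt ((Nat.modEq_iff_dvd' hle).mp hij) (by omega)
    omega
  · have := Nat.eq_zero_of_dvd_of_lt ((Nat.modEq_iff_dvd' hle).mp hij.symm) (by omega)
    omega

theorem wheelGraph_edgeSet {n : ℕ} (hn : 4 ≤ n) :
    (wheelGraph n).edgeSet =
      (fun i => s(wheelHub hn, wheelRim hn i)) '' Set.Iio (n - 1) ∪
        (fun i => s(wheelRim hn i, wheelRim hn (i + 1))) '' Set.Iio (n - 1) := by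
  have key : ∀ a b : Fin n, a ≠ b →
      (a.val = 0 ∨
        (a.val ≠ 0 ∧ b.val ≠ 0 ∧ (a.val + 1 = b.val ∨ (a.val = 1 ∧ b.val = n - 1)))) →
      s(a, b) ∈ (fun i => s(wheelHub hn, wheelRim hn i)) '' Set.Iio (n - 1) ∪
        (fun i => s(wheelRim hn i, wheelRim hn (i + 1))) '' Set.Iio (n - 1) := by
    rintro ⟨a, ha⟩ ⟨b, hb⟩ hab h
    simp only [ne_eq, Fin.mk.injEq] at hab h
    rcases h with rfl | ⟨ha0, hb0, rfl | ⟨rfl, rfl⟩⟩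
    · refine .inl ⟨b - 1, by simp only [Set.mem_Iio]; omega, ?_⟩
      simp only [wheelHub, wheelRim, Nat.mod_eq_of_lt (show b - 1 < n - 1 by omega)]
      simp only [Nat.sub_add_cancel (show 1 ≤ b by omega)]
    · refine .inr ⟨a - 1, by simp only [Set.mem_Iio]; omega, ?_⟩
      simp only [wheelRim, Nat.sub_add_cancel (show 1 ≤ a by omega),
        Nat.mod_eq_of_lt (show a - 1 < n - 1 by omega), Nat.mod_eq_of_lt (show a < n - 1 by omega)]
    · refine .inr ⟨n - 2, by simp only [Set.mem_Iio]; omega, ?_⟩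
      simp only [wheelRim, show n - 2 + 1 = n - 1 by omega, Nat.mod_self,
        Nat.mod_eq_of_lt (show n - 2 < n - 1 by omega)]
      exact Sym2.eq_swap
  ext e
  constructor
  · induction e with
    | _ a b =>
      intro h
      rw [SimpleGraph.mem_edgeSet, wheelGraph, SimpleGraph.fromRel_adj] at h
      obtain ⟨hab, h | h⟩ := h
      · exact key a b hab h
      · rw [Sym2.eq_swap]
        exact key b a hab.symm h
  · rintro (⟨i, -, rfl⟩ | ⟨i, -, rfl⟩)
    · exact wheelGraph_adj_hub_rim hn i
    · exact wheelGraph_adj_rim_succ hn i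

theorem wheelGraph_edgePancyclic {n : ℕ} (hn : 4 ≤ n) : (wheelGraph n).EdgePancyclic := by
  intro k hk hkn e he
  rw [Fintype.card_fin] at hkn
  have hcycle (s : ℕ) := SimpleGraph.exists_isCycle_of_adj (wheelGraph_adj_rim_succ hn)
    (wheelGraph_adj_hub_rim hn) s (k - 3) (wheelRim_injOn hn (by omega))
  rw [wheelGraph_edgeSet hn] at he
  rcases he with ⟨s, -, rfl⟩ | ⟨s, -, rfl⟩ <;> obtain ⟨w, hw, hl, h₁, h₂⟩ := hcycle s
  · exact ⟨_, w, hw, by omega, h₁⟩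
  · exact ⟨_, w, hw, by omega, h₂⟩

theorem wheelGraph_ncard_edgeSet {n : ℕ} (hn : 4 ≤ n) :
    (wheelGraph n).edgeSet.ncard = 2 * n - 2 := by
  have hspoke : Set.InjOn (fun i => s(wheelHub hn, wheelRim hn i)) (Set.Iio (n - 1)) := by
    intro i hi j hj h
    simp only [Set.mem_Iio] at hi hj
    simpa [wheelHub, wheelRim, Nat.mod_eq_of_lt hi, Nat.mod_eq_of_lt hj] using h
  have hrim : Set.InjOn (fun i => s(wheelRim hn i, wheelRim hn (i + 1))) (Set.Iio (n - 1)) := by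
    intro i hi j hj h
    simp only [Set.mem_Iio] at hi hj
    simp only [wheelRim, Sym2.eq_iff, Fin.mk.injEq, succ_mod_eq_ite (show 2 ≤ n - 1 by omega),
      Nat.mod_eq_of_lt hi, Nat.mod_eq_of_lt hj] at h
    split_ifs at h <;> omega
  have hdisj : Disjoint ((fun i => s(wheelHub hn, wheelRim hn i)) '' Set.Iio (n - 1))
      ((fun i => s(wheelRim hn i, wheelRim hn (i + 1))) '' Set.Iio (n - 1)) := by
    rw [Set.disjoint_left]
    rintro _ ⟨i, -, rfl⟩ ⟨j, -, h⟩
    simp [wheelHub, wheelRim] at h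
  rw [wheelGraph_edgeSet hn, Set.ncard_union_eq hdisj ((Set.finite_Iio _).image _)
    ((Set.finite_Iio _).image _), hspoke.ncard_image, hrim.ncard_image,
    Set.ncard_eq_toFinset_card', Set.toFinset_Iio, Nat.card_Iio]
  omega

/-- for `n ≥ 4`, the wheel `W_n` is edge-pancyclic with exactly `2n - 2` edges;
consequently there exists an edge-pancyclic graph of order `n` with at most `2n - 2` edges. -/
theorem statement_1 (n : ℕ) (hn : 4 ≤ n) :
    ((wheelGraph n).EdgePancyclic ∧ (wheelGraph n).edgeSet.ncard = 2 * n - 2) ∧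
    ∃ G : SimpleGraph (Fin n), G.EdgePancyclic ∧ G.edgeSet.ncard ≤ 2 * n - 2 := by
  have hcard := wheelGraph_ncard_edgeSet hn
  exact ⟨⟨wheelGraph_edgePancyclic hn, hcard⟩, wheelGraph n, wheelGraph_edgePancyclic hn, hcard.le⟩
end

section
/- For every integer k ≥ 2, the graph A_{3k} is a 3-edge-proper graph of order 3k with exactly 5k edges; hence the lower bound e(G) ≥ ⌈5n/3⌉ for 3-edge-proper graphs of order n is attained when n = 3k. -/
/-- The graph `A_{3k}`: a cycle `v_1 … v_{2k} v_1` (here `Sum.inl i` is `v_{i+1}`)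
together with `k` extra vertices `u_1, …, u_k` (here `Sum.inr j` is `u_{j+1}`), where
`u_i` is joined to `v_{2i-1}`, `v_{2i}` and `v_{2i+1}` (indices of the `v`'s mod `2k`). -/
def graphA (k : ℕ) : SimpleGraph (Fin (2 * k) ⊕ Fin k) :=
  SimpleGraph.fromRel (fun a b =>
    match a, b with
    | Sum.inl i, Sum.inl i' => (i.val + 1) % (2 * k) = i'.val
    | Sum.inr j, Sum.inl i =>
        i.val = 2 * j.val ∨ i.val = 2 * j.val + 1 ∨ i.val = (2 * j.val + 2) % (2 * k)
    | _, _ => False)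

namespace SimpleGraph

variable {V : Type*} {G : SimpleGraph V}

/-- A sequence of consecutively adjacent vertices traces a walk. -/
theorem exists_walk_of_seq (f : ℕ → V) (n : ℕ) (hadj : ∀ i < n, G.Adj (f i) (f (i + 1))) :
    ∃ p : G.Walk (f 0) (f n), p.length = n ∧ p.support = (List.range (n + 1)).map f ∧
      ∀ i < n, s(f i, f (i + 1)) ∈ p.edges := by
  induction n generalizing f with
  | zero => exact ⟨.nil, by simp⟩
  | succ n ih =>
    obtain ⟨p, hl, hs, he⟩ := ih (fun i => f (i + 1)) fun i hi => hadj (i + 1) (by omega)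
    refine ⟨.cons (hadj 0 (by omega)) p, by simp [hl], ?_, ?_⟩
    · rw [Walk.support_cons, hs, List.range_succ_eq_map (n := n + 1)]
      simp [Function.comp_def]
    · rintro (_ | i) hi
      · simp
      · exact List.mem_cons_of_mem _ (he i (by omega))

/-- A closed sequence of consecutively adjacent, otherwise distinct vertices traces a cycle. -/
theorem exists_isCycle_of_seq (f : ℕ → V) (n : ℕ) (hn : 3 ≤ n)
    (hadj : ∀ i < n, G.Adj (f i) (f (i + 1))) (hclosed : f n = f 0)
    (hinj : Set.InjOn f (Set.Iio n)) :
    ∃ c : G.Walk (f 0) (f 0), c.IsCycle ∧ c.length = n ∧ ∀ i < n, s(f i, f (i + 1)) ∈ c.edges := by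
  obtain ⟨p, hl, hs, he⟩ := exists_walk_of_seq f n hadj
  refine ⟨p.copy rfl hclosed, ?_, by simpa using hl, by simpa using he⟩
  rw [Walk.isCycle_iff_isPath_tail_and_le_length]
  have hnil : ¬ (p.copy rfl hclosed).Nil := by
    rw [Walk.not_nil_iff_lt_length]
    simp only [Walk.length_copy]
    omega
  refine ⟨?_, by simpa [hl] using hn⟩
  rw [Walk.isPath_def, Walk.support_tail_of_not_nil _ hnil, Walk.support_copy, hs,
    List.range_succ_eq_map, List.map_cons, List.tail_cons, List.map_map]
  refine List.Nodup.map_on ?_ List.nodup_range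
  intro i hi j hj hij
  rw [List.mem_range] at hi hj
  simp only [Function.comp_apply] at hij
  have key : ∀ i < n, ∃ i' < n, f (i + 1) = f i' ∧ (i' = i + 1 ∨ i' = 0 ∧ i + 1 = n) := by
    intro i hi
    rcases Nat.lt_or_ge (i + 1) n with h | h
    · exact ⟨i + 1, h, rfl, .inl rfl⟩
    · obtain rfl : n = i + 1 := by omega
      exact ⟨0, by omega, hclosed, .inr ⟨rfl, rfl⟩⟩
  obtain ⟨i', hi', hfi, hi''⟩ := key i hi
  obtain ⟨j', hj', hfj, hj''⟩ := key j hj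
  have := hinj hi' hj' (hfi.symm.trans (hij.trans hfj))
  omega

/-- Every edge of a triangle lies in a cycle of length three. -/
theorem edgeInCycleOfLength_three {a b c : V} (hab : G.Adj a b) (hbc : G.Adj b c)
    (hca : G.Adj c a) : G.EdgeInCycleOfLength s(a, b) 3 := by
  refine ⟨a, .cons hab (.cons hbc (.cons hca .nil)), ?_, rfl, by simp⟩
  rw [Walk.isCycle_iff_isPath_tail_and_le_length]
  simp [hbc.ne, hca.ne, hab.ne']

end SimpleGraph

namespace graphA

variable {k : ℕ}

/-- The rim vertices of `graphA k`, indexed cyclically from `0`. -/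
def rim (hk : 2 ≤ k) (i : ℕ) : Fin (2 * k) ⊕ Fin k := .inl ⟨i % (2 * k), Nat.mod_lt _ (by omega)⟩

/-- The vertices of `graphA k` off the rim, indexed cyclically from `0`. -/
def hub (hk : 2 ≤ k) (j : ℕ) : Fin (2 * k) ⊕ Fin k := .inr ⟨j % k, Nat.mod_lt _ (by omega)⟩

theorem rim_inj (hk : 2 ≤ k) {i j : ℕ} : rim hk i = rim hk j ↔ i % (2 * k) = j % (2 * k) := by
  simp [rim]

theorem hub_inj (hk : 2 ≤ k) {i j : ℕ} : hub hk i = hub hk j ↔ i % k = j % k := by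
  simp [hub]

theorem rim_ne_hub (hk : 2 ≤ k) (i j : ℕ) : rim hk i ≠ hub hk j := by
  simp [rim, hub]

theorem mod_two_mul_succ_ne (hk : 2 ≤ k) (i : ℕ) : i % (2 * k) ≠ (i + 1) % (2 * k) := by
  intro h
  have h1 : (2 * k) ∣ i + 1 - i := (Nat.modEq_iff_dvd' (by omega)).1 h
  have := Nat.le_of_dvd (by omega) h1
  omega

theorem adj_rim (hk : 2 ≤ k) (i : ℕ) : (graphA k).Adj (rim hk i) (rim hk (i + 1)) := by
  rw [graphA, SimpleGraph.fromRel_adj]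
  refine ⟨fun h => mod_two_mul_succ_ne hk i ((rim_inj hk).1 h), .inl ?_⟩
  simp [rim]

theorem adj_hub (hk : 2 ≤ k) (j t : ℕ) (ht : t < 3) :
    (graphA k).Adj (hub hk j) (rim hk (2 * j + t)) := by
  rw [graphA, SimpleGraph.fromRel_adj]
  refine ⟨(rim_ne_hub hk _ _).symm, .inl ?_⟩
  have hj : 2 * (j % k) = (2 * j) % (2 * k) := (Nat.mul_mod_mul_left ..).symm
  have hlt : j % k < k := Nat.mod_lt _ (by omega)
  have hmod : (2 * j + t) % (2 * k) = (2 * (j % k) + t) % (2 * k) := by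
    rw [hj, Nat.mod_add_mod]
  simp only [rim, hub, hmod]
  interval_cases t
  · exact .inl (Nat.mod_eq_of_lt (by omega))
  · exact .inr (.inl (Nat.mod_eq_of_lt (by omega)))
  · exact .inr (.inr rfl)

/-- The edges of `graphA k`: rim edges on the left, edges at the remaining vertices on the right. -/
def edge (hk : 2 ≤ k) : Fin (2 * k) ⊕ Fin k × Fin 3 → Sym2 (Fin (2 * k) ⊕ Fin k)
  | .inl i => s(rim hk i, rim hk (i + 1))
  | .inr (j, t) => s(hub hk j, rim hk (2 * j + t))

theorem edgeSet_eq_range_edge (hk : 2 ≤ k) : (graphA k).edgeSet = Set.range (edge hk) := by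
  ext e
  constructor
  · have key : ∀ a b, (graphA k).Adj a b → s(a, b) ∈ Set.range (edge hk) := by
      have hrim : ∀ i : Fin (2 * k), rim hk i = .inl i := fun i => by
        simp [rim, Nat.mod_eq_of_lt i.isLt]
      have hhub : ∀ j : Fin k, hub hk j = .inr j := fun j => by
        simp [hub, Nat.mod_eq_of_lt j.isLt]
      have hrr : ∀ i i' : Fin (2 * k), (i.val + 1) % (2 * k) = i'.val →
          s(.inl i, .inl i') ∈ Set.range (edge hk) := fun i i' h =>
        ⟨.inl i, by simp only [edge, hrim]; congr 2; simp [rim, h]⟩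
      have hhr : ∀ (j : Fin k) (i : Fin (2 * k)),
          (i.val = 2 * j.val ∨ i.val = 2 * j.val + 1 ∨ i.val = (2 * j.val + 2) % (2 * k)) →
          s(.inr j, .inl i) ∈ Set.range (edge hk) := by
        intro j i h
        have : ∃ t : Fin 3, (2 * j.val + t.val) % (2 * k) = i.val := by
          rcases h with h | h | h
          · exact ⟨0, by rw [h]; exact Nat.mod_eq_of_lt (by omega)⟩
          · exact ⟨1, by rw [h]; exact Nat.mod_eq_of_lt (by omega)⟩
          · exact ⟨2, h.symm⟩
        obtain ⟨t, ht⟩ := this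
        exact ⟨.inr (j, t), by simp only [edge, hhub]; congr 2; simp [rim, ht]⟩
      intro a b hab
      rw [graphA, SimpleGraph.fromRel_adj] at hab
      rcases a with i | j <;> rcases b with i' | j' <;>
        simp only [or_false, false_or, or_self, and_false] at hab
      · rcases hab.2 with h | h
        · exact hrr _ _ h
        · rw [Sym2.eq_swap]; exact hrr _ _ h
      · rw [Sym2.eq_swap]; exact hhr _ _ hab.2
      · exact hhr _ _ hab.2
    induction e with | _ a b => exact key a b
  · rintro ⟨i | ⟨j, t⟩, rfl⟩
    · exact adj_rim hk i
    · exact adj_hub hk j t t.isLt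

theorem edge_injective (hk : 2 ≤ k) : Function.Injective (edge hk) := by
  have hdiff : ∀ a b, a ≤ b → b < a + 2 * k → a % (2 * k) = b % (2 * k) → a = b := by
    intro a b hab hlt h
    by_contra hne
    have := Nat.le_of_dvd (by omega) ((Nat.modEq_iff_dvd' hab).1 h)
    omega
  rintro (i | ⟨j, t⟩) (i' | ⟨j', t'⟩) h
  · simp only [edge, Sym2.eq_iff, rim_inj] at h
    have hi := i.isLt
    have hi' := i'.isLt
    congr 1
    ext
    rcases h with h | h
    · simpa [Nat.mod_eq_of_lt] using h.1
    · exfalso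
      have h1 := hdiff _ _ (by omega) (by omega) (show i.val % (2 * k) = (i.val + 2) % (2 * k) by
        rw [h.1, ← Nat.mod_add_mod, ← h.2, Nat.mod_add_mod])
      omega
  · simp [edge, rim_ne_hub] at h
  · simp [edge, (rim_ne_hub hk _ _).symm] at h
  · simp only [edge, Sym2.eq_iff, rim_inj, hub_inj, (rim_ne_hub hk _ _).symm, false_and,
      or_false, Nat.mod_eq_of_lt j.isLt, Nat.mod_eq_of_lt j'.isLt] at h
    obtain ⟨h1, h2⟩ := h
    obtain rfl : j = j' := Fin.ext h1
    have : t = t' := by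
      ext
      rcases le_total t.val t'.val with hle | hle
      · have := hdiff _ _ (by omega) (by omega) h2
        omega
      · have := hdiff _ _ (by omega) (by omega) h2.symm
        omega
    rw [this]

theorem ncard_edgeSet (hk : 2 ≤ k) : (graphA k).edgeSet.ncard = 5 * k := by
  rw [edgeSet_eq_range_edge hk, Set.ncard_range_of_injective (edge_injective hk)]
  simp
  omega

/-- A Hamiltonian tour of `graphA k`: between `rim (2 * j)` and `rim (2 * j + 2)` it visits
`rim (2 * j + 1)` and `hub j`, the former at position `t` of the block, where `t` is `1` or `2`. -/
def tour (hk : 2 ≤ k) (t n : ℕ) : Fin (2 * k) ⊕ Fin k :=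
  if n % 3 = 0 then rim hk (2 * (n / 3))
  else if n % 3 = t then rim hk (2 * (n / 3) + 1)
  else hub hk (n / 3)

theorem tour_mul (hk : 2 ≤ k) (t j : ℕ) : tour hk t (3 * j) = rim hk (2 * j) := by
  simp [tour]

theorem tour_mul_add (hk : 2 ≤ k) {t r : ℕ} (hr : r = 1 ∨ r = 2) (j : ℕ) :
    tour hk t (3 * j + r) = if r = t then rim hk (2 * j + 1) else hub hk j := by
  have h1 : (3 * j + r) % 3 = r := by omega
  have h2 : (3 * j + r) / 3 = j := by omega
  have h3 : r ≠ 0 := by omega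
  simp [tour, h1, h2, h3]

theorem adj_tour (hk : 2 ≤ k) {t : ℕ} (ht : t = 1 ∨ t = 2) (n : ℕ) :
    (graphA k).Adj (tour hk t n) (tour hk t (n + 1)) := by
  obtain ⟨j, r, hr, rfl⟩ : ∃ j r, r < 3 ∧ n = 3 * j + r := ⟨n / 3, n % 3, by omega, by omega⟩
  have h3 : tour hk t (3 * j + 2 + 1) = rim hk (2 * j + 2) := tour_mul hk t (j + 1)
  have h0 := adj_rim hk (2 * j)
  have h1 := adj_rim hk (2 * j + 1)
  have h2 := fun s hs => adj_hub hk j s hs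
  interval_cases r
  · rw [add_zero, tour_mul, tour_mul_add hk (.inl rfl)]
    split_ifs
    · exact h0
    · exact (h2 0 (by omega)).symm
  · rw [add_assoc, tour_mul_add hk (.inl rfl), tour_mul_add hk (.inr rfl)]
    rcases ht with rfl | rfl
    · exact (h2 1 (by omega)).symm
    · exact h2 1 (by omega)
  · rw [h3, tour_mul_add hk (.inr rfl)]
    split_ifs
    · exact h1
    · exact h2 2 (by omega)

theorem injOn_tour (hk : 2 ≤ k) {t : ℕ} (ht : t = 1 ∨ t = 2) :
    Set.InjOn (tour hk t) (Set.Iio (3 * k)) := by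
  intro m hm n hn h
  simp only [Set.mem_Iio] at hm hn
  have hlt : ∀ {m}, m < 3 * k → 2 * (m / 3) % (2 * k) = 2 * (m / 3) ∧
      (2 * (m / 3) + 1) % (2 * k) = 2 * (m / 3) + 1 ∧ (m / 3) % k = m / 3 := fun hm =>
    ⟨Nat.mod_eq_of_lt (by omega), Nat.mod_eq_of_lt (by omega), Nat.mod_eq_of_lt (by omega)⟩
  unfold tour at h
  split_ifs at h <;>
    simp only [rim_inj, hub_inj, rim_ne_hub, (rim_ne_hub hk _ _).symm, hlt hm, hlt hn] at h <;>
    omega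

/-- Every edge of the tour lies in a Hamiltonian cycle of `graphA k`. -/
theorem exists_isHamiltonianCycle (hk : 2 ≤ k) {t : ℕ} (ht : t = 1 ∨ t = 2) {n : ℕ}
    (hn : n < 3 * k) :
    ∃ (v : Fin (2 * k) ⊕ Fin k) (c : (graphA k).Walk v v), c.IsHamiltonianCycle ∧
      s(tour hk t n, tour hk t (n + 1)) ∈ c.edges := by
  have hclosed : tour hk t (3 * k) = tour hk t 0 := by
    rw [tour_mul, show tour hk t 0 = rim hk 0 from tour_mul hk t 0, rim_inj]
    simp
  obtain ⟨c, hc, hl, he⟩ := SimpleGraph.exists_isCycle_of_seq (tour hk t) (3 * k) (by omega)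
    (fun i _ => adj_tour hk ht i) hclosed (injOn_tour hk ht)
  refine ⟨_, c, SimpleGraph.Walk.isHamiltonianCycle_iff_isCycle_and_length_eq.2 ⟨hc, ?_⟩, he n hn⟩
  rw [hl]
  simp
  omega

theorem edgeProper_three (hk : 2 ≤ k) : (graphA k).EdgeProper 3 := by
  intro e he
  have htri : (graphA k).EdgeInCycleOfLength e 3 →
      ∀ i : ℕ, 3 ≤ i → i ≤ 3 → (graphA k).EdgeInCycleOfLength e i := by
    intro h i h3 h3'
    rwa [le_antisymm h3' h3]
  rw [edgeSet_eq_range_edge hk] at he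
  have hham : ∀ (t r : ℕ), (t = 1 ∨ t = 2) → r < 3 → ∀ j < k,
      ∃ (v : Fin (2 * k) ⊕ Fin k) (c : (graphA k).Walk v v), c.IsHamiltonianCycle ∧
        s(tour hk t (3 * j + r), tour hk t (3 * j + (r + 1))) ∈ c.edges :=
    fun t r ht hr j hj => exists_isHamiltonianCycle hk ht (n := 3 * j + r) (by omega)
  have hsucc : ∀ t j, tour hk t (3 * j + 3) = rim hk (2 * j + 2) :=
    fun t j => tour_mul hk t (j + 1)
  have hone := fun t j => tour_mul_add hk (t := t) (.inl rfl) j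
  have htwo := fun t j => tour_mul_add hk (t := t) (.inr rfl) j
  obtain ⟨i | ⟨j, t, ht⟩, rfl⟩ := he
  · obtain ⟨j, hj | hj⟩ : ∃ j, i.val = 2 * j ∨ i.val = 2 * j + 1 := ⟨i / 2, by omega⟩
    · have hlt : j < k := by omega
      rw [edge, hj] at htri ⊢
      refine ⟨htri (SimpleGraph.edgeInCycleOfLength_three (adj_rim hk (2 * j))
        (adj_hub hk j 1 (by omega)).symm (adj_hub hk j 0 (by omega))), ?_⟩
      simpa [tour_mul, hone] using hham 1 0 (.inl rfl) (by omega) j hlt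
    · have hlt : j < k := by omega
      rw [edge, hj] at htri ⊢
      refine ⟨htri (SimpleGraph.edgeInCycleOfLength_three (adj_rim hk (2 * j + 1))
        (adj_hub hk j 2 (by omega)).symm (adj_hub hk j 1 (by omega))), ?_⟩
      simpa [hsucc, htwo] using hham 2 2 (.inr rfl) (by omega) j hlt
  · simp only [edge]
    interval_cases t
    · refine ⟨htri (SimpleGraph.edgeInCycleOfLength_three (adj_hub hk j 0 (by omega))
        (adj_rim hk _) (adj_hub hk j 1 (by omega)).symm), ?_⟩
      rw [Sym2.eq_swap]
      simpa [tour_mul, hone] using hham 2 0 (.inr rfl) (by omega) j j.isLt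
    · refine ⟨htri (SimpleGraph.edgeInCycleOfLength_three (adj_hub hk j 1 (by omega))
        (adj_rim hk _) (adj_hub hk j 2 (by omega)).symm), ?_⟩
      simpa [hone, htwo] using hham 2 1 (.inr rfl) (by omega) j j.isLt
    · refine ⟨htri (SimpleGraph.edgeInCycleOfLength_three (adj_hub hk j 2 (by omega))
        (adj_rim hk (2 * j + 1)).symm (adj_hub hk j 1 (by omega)).symm), ?_⟩
      simpa [hsucc, htwo] using hham 1 2 (.inl rfl) (by omega) j j.isLt

end graphA

/-- for `k ≥ 2`, `A_{3k}` is a 3-edge-proper graph of order `3k` with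
exactly `5k` edges, attaining the bound `⌈5n/3⌉` for `n = 3k`. -/
theorem statement_7 (k : ℕ) (hk : 2 ≤ k) :
    Fintype.card (Fin (2 * k) ⊕ Fin k) = 3 * k ∧
    (graphA k).EdgeProper 3 ∧
    (graphA k).edgeSet.ncard = 5 * k ∧
    ((graphA k).edgeSet.ncard : ℤ) = ⌈(5 * ((3 * k : ℕ) : ℚ)) / 3⌉ := by
  have hcard := graphA.ncard_edgeSet hk
  refine ⟨by simp; omega, graphA.edgeProper_three hk, hcard, ?_⟩
  rw [hcard, show (5 * ((3 * k : ℕ) : ℚ)) / 3 = ((5 * k : ℕ) : ℚ) by push_cast; ring,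
    Int.ceil_natCast]
end

section
/- For every integer k ≥ 2, the graph D^1_{3k+2} is a 3-edge-proper graph of order 3k + 2 with exactly 5k + 4 edges; hence the lower bound e(G) ≥ ⌈5n/3⌉ for 3-edge-proper graphs of order n is attained when n = 3k + 2. -/
/-- The graph `D¹_{3k+2}`: a cycle `v_1 … v_{2k+2} v_1` (here `Sum.inl i` is `v_{i+1}`)
together with `k` extra vertices `u_1, …, u_k` (here `Sum.inr j` is `u_{j+1}`), where
`u_i` is joined to `v_{2i-1}`, `v_{2i}`, `v_{2i+1}`, plus the two extra edges
`v_{2k+1} v_1` and `v_{2k+2} v_2`. -/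
def graphD1 (k : ℕ) : SimpleGraph (Fin (2 * k + 2) ⊕ Fin k) :=
  SimpleGraph.fromRel (fun a b =>
    match a, b with
    | Sum.inl i, Sum.inl i' =>
        (i.val + 1) % (2 * k + 2) = i'.val ∨ (i.val = 2 * k ∧ i'.val = 0) ∨
          (i.val = 2 * k + 1 ∧ i'.val = 1)
    | Sum.inr j, Sum.inl i =>
        i.val = 2 * j.val ∨ i.val = 2 * j.val + 1 ∨ i.val = 2 * j.val + 2
    | _, _ => False)

namespace SimpleGraph

/-- Every pair of cyclically consecutive vertices is an edge of `cycleGraph.cycle`. -/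
theorem cycleGraph.mem_edges_cycle {n : ℕ} {a b : Fin (n + 3)}
    (h : a.val + 1 = b.val ∨ a.val + 1 = n + 3 ∧ b.val = 0) :
    s(a, b) ∈ (cycleGraph.cycle n).edges := by
  have ha := a.isLt
  have hb := b.isLt
  rw [Sym2.eq_swap, Walk.mk_mem_edges_iff_exists]
  rcases h with h | ⟨h, h'⟩
  · refine ⟨n + 3 - b.val, by rw [cycleGraph.length_cycle]; omega, ?_⟩
    rw [cycleGraph.getVert_cycle (by omega), cycleGraph.getVert_cycle (by omega)]
    congr 2 <;> rw [Nat.mod_eq_of_lt] <;> omega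
  · refine ⟨0, by simp, ?_⟩
    rw [cycleGraph.getVert_cycle (by omega), cycleGraph.getVert_cycle (by omega)]
    congr 2
    · simp [h']
    · rw [Nat.mod_eq_of_lt] <;> omega

theorem EdgeInCycleOfLength.of_triangle {V : Type*} {G : SimpleGraph V} {a b c : V}
    (hab : G.Adj a b) (hbc : G.Adj b c) (hca : G.Adj c a) :
    G.EdgeInCycleOfLength s(a, b) 3 :=
  ⟨a, .cons hab (.cons hbc (.cons hca .nil)), by
    have := hab.ne
    have := hbc.ne
    have := hca.ne
    simp [Walk.cons_isCycle_iff, Walk.cons_isPath_iff]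
    grind, by simp, by simp⟩

/-- Numbering the vertices so that cyclically consecutive vertices are adjacent gives a
Hamilton cycle through all the corresponding edges. -/
theorem exists_isHamiltonianCycle_of_numbering {V : Type*} [Fintype V] [DecidableEq V]
    {G : SimpleGraph V} (pos : V → ℕ) (hcard : 3 ≤ Fintype.card V)
    (hinj : Function.Injective pos) (hlt : ∀ a, pos a < Fintype.card V)
    (hadj : ∀ a b, (pos a + 1 = pos b ∨ pos a + 1 = Fintype.card V ∧ pos b = 0) → G.Adj a b) :
    ∃ (v : V) (c : G.Walk v v), c.IsHamiltonianCycle ∧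
      ∀ a b, (pos a + 1 = pos b ∨ pos a + 1 = Fintype.card V ∧ pos b = 0) →
        s(a, b) ∈ c.edges := by
  obtain ⟨n, hn⟩ := Nat.exists_eq_add_of_le' hcard
  rw [hn] at hlt hadj ⊢
  have hbij : Function.Bijective (fun a => (⟨pos a, hlt a⟩ : Fin (n + 3))) :=
    (Fintype.bijective_iff_injective_and_card _).2
      ⟨fun a b h => hinj (Fin.ext_iff.1 h), by simp [hn]⟩
  let σ : V ≃ Fin (n + 3) := Equiv.ofBijective _ hbij
  have hσ (i : Fin (n + 3)) : pos (σ.symm i) = i.val :=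
    congrArg Fin.val (σ.apply_symm_apply i)
  have hstep {i j : Fin (n + 3)} (h : (i - j).val = 1) : G.Adj (σ.symm j) (σ.symm i) := by
    refine hadj _ _ ?_
    rw [hσ, hσ]
    have hi := i.isLt
    have hj := j.isLt
    rcases le_or_gt j i with hle | hlt
    · rw [Fin.sub_val_of_le hle] at h
      omega
    · rw [Fin.coe_sub_iff_lt.2 hlt] at h
      rw [Fin.lt_def] at hlt
      omega
  let f : cycleGraph (n + 3) →g G :=
    { toFun := σ.symm
      map_rel' := fun {i j} h => by
        rcases cycleGraph_adj'.1 h with h | h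
        · exact (hstep h).symm
        · exact hstep h }
  refine ⟨_, (cycleGraph.cycle n).map f, Walk.IsHamiltonianCycle.map σ.symm.bijective ?_, ?_⟩
  · rw [Walk.isHamiltonianCycle_iff_isCycle_and_length_eq]
    exact ⟨cycleGraph.isCycle_cycle, by simp⟩
  · intro a b h
    rw [Walk.edges_map, List.mem_map]
    exact ⟨s(σ a, σ b), cycleGraph.mem_edges_cycle h, by simp [f]⟩

end SimpleGraph

namespace graphD1

variable {k : ℕ}

/-- Adjacency among the cycle vertices, oriented along the cycle. -/
def Forward (i j : Fin (2 * k + 2)) : Prop :=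
  i.val + 1 = j.val ∨ 2 * k ≤ i.val ∧ j.val = 0 ∨ i.val = 2 * k + 1 ∧ j.val = 1

theorem adj_inl_inl {i j : Fin (2 * k + 2)} :
    (graphD1 k).Adj (Sum.inl i) (Sum.inl j) ↔ i ≠ j ∧ (Forward i j ∨ Forward j i) := by
  have hmod (a b : Fin (2 * k + 2)) :
      (a.val + 1) % (2 * k + 2) = b.val ↔ a.val + 1 = b.val ∨ a.val = 2 * k + 1 ∧ b.val = 0 := by
    rcases Nat.lt_or_ge (a.val + 1) (2 * k + 2) with h | h
    · rw [Nat.mod_eq_of_lt h]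
      omega
    · have ha : a.val + 1 = 2 * k + 2 := by omega
      rw [ha, Nat.mod_self]
      omega
  simp only [graphD1, SimpleGraph.fromRel_adj, hmod, Forward, ne_eq, Sum.inl.injEq]
  omega

theorem adj_inr_inl {j : Fin k} {i : Fin (2 * k + 2)} :
    (graphD1 k).Adj (Sum.inr j) (Sum.inl i) ↔ 2 * j.val ≤ i.val ∧ i.val ≤ 2 * j.val + 2 := by
  simp only [graphD1, SimpleGraph.fromRel_adj, ne_eq, reduceCtorEq, not_false_eq_true, true_and,
    or_false]
  omega

theorem adj_inl_inr {j : Fin k} {i : Fin (2 * k + 2)} :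
    (graphD1 k).Adj (Sum.inl i) (Sum.inr j) ↔ 2 * j.val ≤ i.val ∧ i.val ≤ 2 * j.val + 2 := by
  rw [SimpleGraph.adj_comm, adj_inr_inl]

theorem not_adj_inr_inr {i j : Fin k} : ¬ (graphD1 k).Adj (Sum.inr i) (Sum.inr j) := by
  simp [graphD1]

theorem card_vertices : Fintype.card (Fin (2 * k + 2) ⊕ Fin k) = 3 * k + 2 := by
  simp only [Fintype.card_sum, Fintype.card_fin]
  omega

/-- The Hamilton cycle passing through `v_{2j-1}, u_j, v_{2j}, v_{2j+1}` for every `j`. -/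
def extraFirst (k : ℕ) : Fin (2 * k + 2) ⊕ Fin k → ℕ
  | Sum.inl i => if i.val = 2 * k + 1 then 3 * k + 1 else 3 * (i.val / 2) + 2 * (i.val % 2)
  | Sum.inr j => 3 * j.val + 1

/-- The Hamilton cycle passing through `v_{2j-1}, v_{2j}, u_j, v_{2j+1}` for every `j`. -/
def extraSecond (k : ℕ) : Fin (2 * k + 2) ⊕ Fin k → ℕ
  | Sum.inl i => 3 * (i.val / 2) + i.val % 2
  | Sum.inr j => 3 * j.val + 2

/-- The previous Hamilton cycle with `v_1` and `v_{2k+2}` interchanged. -/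
def swapped (k : ℕ) : Fin (2 * k + 2) ⊕ Fin k → ℕ
  | Sum.inl i =>
      if i.val = 0 then 3 * k + 1 else if i.val = 2 * k + 1 then 0
        else 3 * (i.val / 2) + i.val % 2
  | Sum.inr j => 3 * j.val + 2

/-- `b` comes right after `a` in the cyclic order given by `pos`. -/
def Consecutive (pos : Fin (2 * k + 2) ⊕ Fin k → ℕ) (a b : Fin (2 * k + 2) ⊕ Fin k) :
    Prop :=
  pos a + 1 = pos b ∨ pos a + 1 = 3 * k + 2 ∧ pos b = 0

theorem exists_cycle_of_numbering (hk : 1 ≤ k) {pos : Fin (2 * k + 2) ⊕ Fin k → ℕ}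
    (hinj : Function.Injective pos) (hlt : ∀ a, pos a < 3 * k + 2)
    (hadj : ∀ a b, Consecutive pos a b → (graphD1 k).Adj a b)
    {a b : Fin (2 * k + 2) ⊕ Fin k} (hab : Consecutive pos a b) :
    ∃ (v : _) (c : (graphD1 k).Walk v v), c.IsHamiltonianCycle ∧ s(a, b) ∈ c.edges := by
  obtain ⟨v, c, hc, hedges⟩ := SimpleGraph.exists_isHamiltonianCycle_of_numbering
    (G := graphD1 k) pos (by rw [card_vertices]; omega) hinj (by rwa [card_vertices])
    (by rwa [card_vertices])
  rw [card_vertices] at hedges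
  exact ⟨v, c, hc, hedges a b hab⟩

theorem exists_cycle_of_extraFirst (hk : 1 ≤ k) {a b : Fin (2 * k + 2) ⊕ Fin k}
    (hab : Consecutive (extraFirst k) a b) :
    ∃ (v : _) (c : (graphD1 k).Walk v v), c.IsHamiltonianCycle ∧ s(a, b) ∈ c.edges := by
  refine exists_cycle_of_numbering hk ?_ ?_ ?_ hab
  · rintro (i | j) (i' | j') hpos <;> simp only [extraFirst] at hpos <;>
      simp only [Sum.inl.injEq, Sum.inr.injEq, reduceCtorEq] <;> (try split_ifs at hpos) <;> omega
  · rintro (i | j) <;> simp only [extraFirst] <;> (try split_ifs) <;> omega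
  · rintro (i | j) (i' | j') hpos <;> simp only [extraFirst, Consecutive] at hpos <;>
      simp only [adj_inl_inl, adj_inr_inl, adj_inl_inr, not_adj_inr_inr, Forward] <;>
      (try split_ifs at hpos) <;> (try simp only [and_false, or_false] at hpos) <;> omega

theorem exists_cycle_of_extraSecond (hk : 1 ≤ k) {a b : Fin (2 * k + 2) ⊕ Fin k}
    (hab : Consecutive (extraSecond k) a b) :
    ∃ (v : _) (c : (graphD1 k).Walk v v), c.IsHamiltonianCycle ∧ s(a, b) ∈ c.edges := by
  refine exists_cycle_of_numbering hk ?_ ?_ ?_ hab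
  · rintro (i | j) (i' | j') hpos <;> simp only [extraSecond] at hpos <;>
      simp only [Sum.inl.injEq, Sum.inr.injEq, reduceCtorEq] <;> omega
  · rintro (i | j) <;> simp only [extraSecond] <;> omega
  · rintro (i | j) (i' | j') hpos <;> simp only [extraSecond, Consecutive] at hpos <;>
      simp only [adj_inl_inl, adj_inr_inl, adj_inl_inr, not_adj_inr_inr, Forward] <;> omega

theorem exists_cycle_of_swapped (hk : 1 ≤ k) {a b : Fin (2 * k + 2) ⊕ Fin k}
    (hab : Consecutive (swapped k) a b) :
    ∃ (v : _) (c : (graphD1 k).Walk v v), c.IsHamiltonianCycle ∧ s(a, b) ∈ c.edges := by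
  refine exists_cycle_of_numbering hk ?_ ?_ ?_ hab
  · rintro (i | j) (i' | j') hpos <;> simp only [swapped] at hpos <;>
      simp only [Sum.inl.injEq, Sum.inr.injEq, reduceCtorEq] <;> (try split_ifs at hpos) <;> omega
  · rintro (i | j) <;> simp only [swapped] <;> (try split_ifs) <;> omega
  · rintro (i | j) (i' | j') hpos <;> simp only [swapped, Consecutive] at hpos <;>
      simp only [adj_inl_inl, adj_inr_inl, adj_inl_inr, not_adj_inr_inr, Forward] <;>
      (try split_ifs at hpos) <;>
      (try simp only [and_false, and_true, or_false, false_or] at hpos) <;>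
      omega

theorem exists_cycle_spoke (hk : 1 ≤ k) {j : Fin k} {i : Fin (2 * k + 2)}
    (h : (graphD1 k).Adj (Sum.inr j) (Sum.inl i)) :
    ∃ (v : _) (c : (graphD1 k).Walk v v),
      c.IsHamiltonianCycle ∧ s(Sum.inr j, Sum.inl i) ∈ c.edges := by
  rw [adj_inr_inl] at h
  obtain hi | hi | hi : i.val = 2 * j.val ∨ i.val = 2 * j.val + 1 ∨ i.val = 2 * j.val + 2 := by
    omega
  · rw [Sym2.eq_swap]
    refine exists_cycle_of_extraFirst hk ?_
    simp only [Consecutive, extraFirst]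
    split_ifs <;> omega
  · refine exists_cycle_of_extraFirst hk ?_
    simp only [Consecutive, extraFirst]
    split_ifs <;> omega
  · refine exists_cycle_of_extraSecond hk ?_
    simp only [Consecutive, extraSecond]
    omega

theorem exists_cycle_forward (hk : 1 ≤ k) {i j : Fin (2 * k + 2)} (h : Forward i j) :
    ∃ (v : _) (c : (graphD1 k).Walk v v),
      c.IsHamiltonianCycle ∧ s(Sum.inl i, Sum.inl j) ∈ c.edges := by
  by_cases hA : Consecutive (extraFirst k) (Sum.inl i) (Sum.inl j)
  · exact exists_cycle_of_extraFirst hk hA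
  by_cases hB : Consecutive (extraSecond k) (Sum.inl i) (Sum.inl j)
  · exact exists_cycle_of_extraSecond hk hB
  refine exists_cycle_of_swapped hk ?_
  simp only [Consecutive, extraFirst, extraSecond, swapped, Forward] at *
  split_ifs at * <;> omega

theorem triangle_spoke {j : Fin k} {i : Fin (2 * k + 2)}
    (h : (graphD1 k).Adj (Sum.inr j) (Sum.inl i)) :
    (graphD1 k).EdgeInCycleOfLength s(Sum.inr j, Sum.inl i) 3 := by
  refine .of_triangle
    (c := Sum.inl ⟨if i.val = 2 * j.val + 1 then 2 * j.val else 2 * j.val + 1,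
      by split_ifs <;> omega⟩) h ?_ ?_ <;>
  rw [adj_inr_inl] at h <;>
  simp only [adj_inl_inl, adj_inl_inr, Forward, ne_eq, Fin.ext_iff] <;> split_ifs <;> omega

theorem triangle_forward (hk : 1 ≤ k) {i j : Fin (2 * k + 2)} (h : Forward i j) :
    (graphD1 k).EdgeInCycleOfLength s(Sum.inl i, Sum.inl j) 3 := by
  have hij : (graphD1 k).Adj (Sum.inl i) (Sum.inl j) := by
    simp only [adj_inl_inl, Forward, ne_eq, Fin.ext_iff] at *
    omega
  by_cases hi : i.val < 2 * k
  · refine .of_triangle (c := Sum.inr ⟨i.val / 2, by omega⟩) hij ?_ ?_ <;>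
    simp only [adj_inl_inr, adj_inr_inl, Forward] at * <;> omega
  · refine .of_triangle
      (c := Sum.inl ⟨if j.val = 0 then 4 * k + 1 - i.val else 0, by split_ifs <;> omega⟩)
      hij ?_ ?_ <;>
    simp only [adj_inl_inl, Forward, ne_eq, Fin.ext_iff] at * <;> split_ifs <;> omega

theorem edgeProper (hk : 1 ≤ k) : (graphD1 k).EdgeProper 3 := by
  suffices h : ∀ e ∈ (graphD1 k).edgeSet, (graphD1 k).EdgeInCycleOfLength e 3 ∧
      ∃ (v : _) (c : (graphD1 k).Walk v v), c.IsHamiltonianCycle ∧ e ∈ c.edges from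
    fun e he => ⟨fun i h₁ h₂ => le_antisymm h₁ h₂ ▸ (h e he).1, (h e he).2⟩
  intro e
  induction e with | h a b
  intro hab
  rw [SimpleGraph.mem_edgeSet] at hab
  rcases a with i | j <;> rcases b with i' | j'
  · rcases (adj_inl_inl.1 hab).2 with h | h
    · exact ⟨triangle_forward hk h, exists_cycle_forward hk h⟩
    · rw [Sym2.eq_swap]
      exact ⟨triangle_forward hk h, exists_cycle_forward hk h⟩
  · rw [Sym2.eq_swap]
    exact ⟨triangle_spoke hab.symm, exists_cycle_spoke hk hab.symm⟩
  · exact ⟨triangle_spoke hab, exists_cycle_spoke hk hab⟩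
  · exact absurd hab not_adj_inr_inr

/-- The cycle edges, the spokes and the two remaining edges. -/
def edge (k : ℕ) :
    Fin (2 * k + 2) ⊕ Fin k × Fin 3 ⊕ Fin 2 → Sym2 (Fin (2 * k + 2) ⊕ Fin k)
  | .inl i => s(.inl i, .inl ⟨if i.val = 2 * k + 1 then 0 else i.val + 1, by split_ifs <;> omega⟩)
  | .inr (.inl (j, r)) => s(.inr j, .inl ⟨2 * j.val + r.val, by omega⟩)
  | .inr (.inr t) => s(.inl ⟨2 * k + t.val, by omega⟩, .inl ⟨t.val, by omega⟩)

theorem edge_injective (hk : 1 ≤ k) : Function.Injective (edge k) := by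
  rintro (i | ⟨j, r⟩ | t) (i' | ⟨j', r'⟩ | t') h <;>
    simp only [edge, Sym2.eq_iff, Sum.inl.injEq, Sum.inr.injEq, reduceCtorEq, Fin.ext_iff,
      Prod.mk.injEq, and_false, false_and, or_false] at h ⊢ <;>
    (try split_ifs at h) <;> omega

theorem range_edge (hk : 1 ≤ k) : Set.range (edge k) = (graphD1 k).edgeSet := by
  have hforward {i j : Fin (2 * k + 2)} (h : Forward i j) :
      s(.inl i, .inl j) ∈ Set.range (edge k) := by
    by_cases hc : i.val + 1 = j.val ∨ i.val = 2 * k + 1 ∧ j.val = 0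
    · refine ⟨.inl i, ?_⟩
      simp only [edge]
      congr 3
      split_ifs <;> omega
    · simp only [Forward] at h
      refine ⟨.inr (.inr ⟨j.val, by omega⟩), ?_⟩
      simp only [edge]
      congr 3
      omega
  have hspoke {j : Fin k} {i : Fin (2 * k + 2)} (h : (graphD1 k).Adj (.inr j) (.inl i)) :
      s(.inr j, .inl i) ∈ Set.range (edge k) := by
    rw [adj_inr_inl] at h
    refine ⟨.inr (.inl (j, ⟨i.val - 2 * j.val, by omega⟩)), ?_⟩
    simp only [edge]
    congr 3
    omega
  refine Set.Subset.antisymm ?_ ?_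
  · rintro _ ⟨i | ⟨j, r⟩ | t, rfl⟩ <;>
      simp only [edge, SimpleGraph.mem_edgeSet, adj_inl_inl, adj_inr_inl, Forward, ne_eq,
        Fin.ext_iff] <;>
      (try split_ifs) <;> omega
  · intro e
    induction e with | h a b
    intro hab
    rw [SimpleGraph.mem_edgeSet] at hab
    rcases a with i | j <;> rcases b with i' | j'
    · rcases (adj_inl_inl.1 hab).2 with h | h
      · exact hforward h
      · rw [Sym2.eq_swap]
        exact hforward h
    · rw [Sym2.eq_swap]
      exact hspoke hab.symm
    · exact hspoke hab
    · exact absurd hab not_adj_inr_inr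

theorem ncard_edgeSet (hk : 1 ≤ k) : (graphD1 k).edgeSet.ncard = 5 * k + 4 := by
  rw [← range_edge hk, Set.ncard_range_of_injective (edge_injective hk)]
  simp only [Nat.card_eq_fintype_card, Fintype.card_sum, Fintype.card_prod, Fintype.card_fin]
  omega

end graphD1

/-- for `k ≥ 2`, `D¹_{3k+2}` is a 3-edge-proper graph of order `3k + 2` with
exactly `5k + 4` edges, attaining the bound `⌈5n/3⌉` for `n = 3k + 2`. -/
theorem statement_9 (k : ℕ) (hk : 2 ≤ k) :
    Fintype.card (Fin (2 * k + 2) ⊕ Fin k) = 3 * k + 2 ∧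
    (graphD1 k).EdgeProper 3 ∧
    (graphD1 k).edgeSet.ncard = 5 * k + 4 ∧
    ((graphD1 k).edgeSet.ncard : ℤ) = ⌈(5 * ((3 * k + 2 : ℕ) : ℚ)) / 3⌉ := by
  have hk' : 1 ≤ k := by omega
  refine ⟨graphD1.card_vertices, graphD1.edgeProper hk', graphD1.ncard_edgeSet hk', ?_⟩
  rw [graphD1.ncard_edgeSet hk', eq_comm, Int.ceil_eq_iff]
  push_cast
  constructor <;> linarith
end

section
/- For every integer k ≥ 2, the graph D^2_{3k+2} is a 3-edge-proper graph of order 3k + 2 with exactly 5k + 4 edges; hence there are at least two non-identical extremal 3-edge-proper graphs of order 3k + 2 attaining the bound e(G) ≥ ⌈5n/3⌉. -/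
/-- The graph `D²_{3k+2}`: obtained from `D¹_{3k+2}` by deleting the edge `v_{2k+1} v_1`
and adding the edge `v_{2k+2} v_{2k}`. -/
def graphD2 (k : ℕ) : SimpleGraph (Fin (2 * k + 2) ⊕ Fin k) :=
  SimpleGraph.fromRel (fun a b =>
    match a, b with
    | Sum.inl i, Sum.inl i' =>
        (i.val + 1) % (2 * k + 2) = i'.val ∨ (i.val = 2 * k + 1 ∧ i'.val = 1) ∨
          (i.val = 2 * k + 1 ∧ i'.val = 2 * k - 1)
    | Sum.inr j, Sum.inl i =>
        i.val = 2 * j.val ∨ i.val = 2 * j.val + 1 ∨ i.val = 2 * j.val + 2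
    | _, _ => False)

namespace SimpleGraph

variable {V : Type*} {G : SimpleGraph V}

/-- A sequence of consecutively adjacent vertices is traced by a walk. -/
theorem exists_walk_of_adj_succ (f : ℕ → V) (m : ℕ) (h : ∀ i < m, G.Adj (f i) (f (i + 1))) :
    ∃ p : G.Walk (f 0) (f m), p.support = (List.range (m + 1)).map f ∧
      p.edges = (List.range m).map fun i => s(f i, f (i + 1)) := by
  induction m with
  | zero => exact ⟨.nil, by simp, by simp⟩
  | succ m ih =>
    obtain ⟨p, hs, he⟩ := ih fun i hi => h i (by omega)
    refine ⟨p.concat (h m (by omega)), ?_, ?_⟩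
    · rw [Walk.support_concat, hs, List.range_succ (n := m + 1)]
      simp
    · rw [Walk.edges_concat, he, List.range_succ (n := m)]
      simp

/-- A closed sequence of `m + 1 ≥ 3` distinct, consecutively adjacent vertices is traced by a
cycle. -/
theorem exists_isCycle_of_adj_succ (f : ℕ → V) (m : ℕ) (hm : 2 ≤ m)
    (hinj : Set.InjOn f {i | i ≤ m}) (h : ∀ i < m, G.Adj (f i) (f (i + 1)))
    (hclose : G.Adj (f m) (f 0)) :
    ∃ c : G.Walk (f m) (f m), c.IsCycle ∧ c.length = m + 1 ∧ s(f m, f 0) ∈ c.edges ∧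
      ∀ i < m, s(f i, f (i + 1)) ∈ c.edges := by
  obtain ⟨p, hs, he⟩ := exists_walk_of_adj_succ f m h
  refine ⟨.cons hclose p, ?_, ?_, by simp, ?_⟩
  · rw [Walk.cons_isCycle_iff, Walk.isPath_def, hs, he]
    refine ⟨List.Nodup.map_on (fun i hi j hj hij => hinj ?_ ?_ hij) List.nodup_range, ?_⟩
    · simpa [Nat.lt_succ_iff] using hi
    · simpa [Nat.lt_succ_iff] using hj
    · simp only [List.mem_map, List.mem_range, not_exists, not_and]
      intro i hi hij
      rcases Sym2.eq_iff.1 hij with ⟨h1, -⟩ | ⟨h1, h2⟩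
      · have := hinj (by simp; omega) (by simp) h1
        omega
      · have := hinj (by simp; omega) (by simp) h1
        have := hinj (by simp; omega) (by simp) h2
        omega
  · have := congrArg List.length hs
    simpa using this
  · intro i hi
    rw [Walk.edges_cons, he]
    exact List.mem_cons_of_mem _ (List.mem_map.2 ⟨i, List.mem_range.2 hi, rfl⟩)

end SimpleGraph

namespace GraphD2

/-- The vertex of `graphD2 k` with number `x`: first the vertices of the cycle in order, then the
additional vertices. -/
def vert (k x : ℕ) : Fin (2 * k + 2) ⊕ Fin k :=
  if h : x < 2 * k + 2 then .inl ⟨x, h⟩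
  else if h : x - (2 * k + 2) < k then .inr ⟨x - (2 * k + 2), h⟩
  else .inl 0

/-- The edges of `graphD2 k`, each in one direction, as pairs of vertex numbers. -/
def Arc (k x y : ℕ) : Prop :=
  (x < 2 * k + 1 ∧ y = x + 1) ∨ (x = 2 * k + 1 ∧ (y = 0 ∨ y = 1 ∨ y = 2 * k - 1)) ∨
    (2 * k + 2 ≤ x ∧ x < 3 * k + 2 ∧ 2 * (x - (2 * k + 2)) ≤ y ∧ y ≤ 2 * (x - (2 * k + 2)) + 2)

variable {k : ℕ}

theorem vert_injOn : Set.InjOn (vert k) {x | x < 3 * k + 2} := by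
  intro x hx y hy h
  simp only [Set.mem_ofPred_eq] at hx hy
  unfold vert at h
  split_ifs at h <;> simp at h <;> omega

theorem Arc.lt {x y : ℕ} (h : Arc k x y) : x < 3 * k + 2 ∧ y < 2 * k + 2 := by
  unfold Arc at h
  omega

theorem vert_inl (i : Fin (2 * k + 2)) : vert k i = .inl i := by
  simp [vert]

theorem vert_inr (j : Fin k) : vert k (2 * k + 2 + j) = .inr j := by
  simp [vert]

theorem succ_mod_eq_iff {n x y : ℕ} (hx : x < n + 1) :
    (x + 1) % (n + 1) = y ↔ (x < n ∧ y = x + 1) ∨ (x = n ∧ y = 0) := by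
  rcases Nat.lt_or_ge x n with h | h
  · rw [Nat.mod_eq_of_lt (by omega)]
    omega
  · obtain rfl : x = n := by omega
    rw [Nat.mod_self]
    omega

theorem Arc.adj {x y : ℕ} (hk : 2 ≤ k) (h : Arc k x y) : (graphD2 k).Adj (vert k x) (vert k y) := by
  obtain ⟨hx, hy⟩ := h.lt
  refine (SimpleGraph.fromRel_adj _ _ _).2 ⟨fun he => ?_, .inl ?_⟩
  · have := vert_injOn hx (by simp; omega) he
    unfold Arc at h
    omega
  · unfold Arc at h
    rcases Nat.lt_or_ge x (2 * k + 2) with hx' | hx'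
    · simp only [vert, hx', hy, dif_pos, succ_mod_eq_iff hx']
      omega
    · simp only [vert, hy, hx'.not_gt, dif_pos, dif_neg, not_false_eq_true,
        show x - (2 * k + 2) < k by omega]
      omega

theorem exists_arc_of_mem_edgeSet {e : Sym2 (Fin (2 * k + 2) ⊕ Fin k)}
    (he : e ∈ (graphD2 k).edgeSet) : ∃ x y, Arc k x y ∧ e = s(vert k x, vert k y) := by
  induction e with | _ a b =>
  rw [SimpleGraph.mem_edgeSet, graphD2, SimpleGraph.fromRel_adj] at he
  have key : ∀ i i' : Fin (2 * k + 2), (i.val + 1) % (2 * k + 2) = i'.val ∨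
      (i.val = 2 * k + 1 ∧ i'.val = 1) ∨ (i.val = 2 * k + 1 ∧ i'.val = 2 * k - 1) →
      Arc k i i' := by
    intro i i' h
    rw [succ_mod_eq_iff i.2] at h
    unfold Arc
    omega
  have key' : ∀ (j : Fin k) (i : Fin (2 * k + 2)), (i.val = 2 * j.val ∨ i.val = 2 * j.val + 1 ∨
      i.val = 2 * j.val + 2) → Arc k (2 * k + 2 + j) i := by
    intro j i h
    unfold Arc
    omega
  rcases a with i | j <;> rcases b with i' | j' <;> rcases he with ⟨-, h | h⟩
  · exact ⟨_, _, key _ _ h, by simp only [vert_inl]⟩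
  · exact ⟨_, _, key _ _ h, by simp only [vert_inl, Sym2.eq_swap]⟩
  · exact h.elim
  · exact ⟨_, _, key' _ _ h, by simp only [vert_inl, vert_inr, Sym2.eq_swap]⟩
  · exact ⟨_, _, key' _ _ h, by simp only [vert_inl, vert_inr]⟩
  · exact h.elim
  · exact h.elim
  · exact h.elim

theorem edgeInCycleOfLength_three {x y : ℕ} (hk : 2 ≤ k) (h : Arc k x y) :
    (graphD2 k).EdgeInCycleOfLength s(vert k x, vert k y) 3 := by
  have tri : ∀ z, (Arc k y z ∨ Arc k z y) → (Arc k z x ∨ Arc k x z) →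
      (graphD2 k).EdgeInCycleOfLength s(vert k x, vert k y) 3 := fun z hyz hzx =>
    SimpleGraph.edgeInCycleOfLength_three (h.adj hk)
      (hyz.elim (fun h => h.adj hk) fun h => (h.adj hk).symm)
      (hzx.elim (fun h => h.adj hk) fun h => (h.adj hk).symm)
  have h' := h
  unfold Arc at h' tri
  rcases h' with ⟨hx, rfl⟩ | ⟨rfl, rfl | rfl | rfl⟩ | ⟨hx, hx', hy, hy'⟩
  · rcases Nat.lt_or_ge x (2 * k) with hx' | hx'
    · exact tri (2 * k + 2 + x / 2) (by omega) (by omega)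
    · exact tri (2 * k - 1) (by omega) (by omega)
  · exact tri 1 (by omega) (by omega)
  · exact tri 0 (by omega) (by omega)
  · exact tri (2 * k) (by omega) (by omega)
  · by_cases hmid : y = 2 * (x - (2 * k + 2)) + 1
    · exact tri (y - 1) (by omega) (by omega)
    · exact tri (2 * (x - (2 * k + 2)) + 1) (by omega) (by omega)

/-- A closed sequence of vertex numbers that visits each vertex of `graphD2 k` once. -/
structure IsTour (k : ℕ) (g : ℕ → ℕ) : Prop where
  lt : ∀ i ≤ 3 * k + 1, g i < 3 * k + 2
  inj : ∀ i ≤ 3 * k + 1, ∀ j ≤ 3 * k + 1, g i = g j → i = j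
  arc : ∀ i < 3 * k + 1, Arc k (g i) (g (i + 1)) ∨ Arc k (g (i + 1)) (g i)
  arc_close : Arc k (g (3 * k + 1)) (g 0)

theorem IsTour.exists_isHamiltonianCycle {g : ℕ → ℕ} (hk : 2 ≤ k) (hg : IsTour k g) :
    ∃ (v : _) (c : (graphD2 k).Walk v v), c.IsHamiltonianCycle ∧
      s(vert k (g (3 * k + 1)), vert k (g 0)) ∈ c.edges ∧
      ∀ i < 3 * k + 1, s(vert k (g i), vert k (g (i + 1))) ∈ c.edges := by
  obtain ⟨c, hc, hl, h0, hi⟩ := SimpleGraph.exists_isCycle_of_adj_succ (G := graphD2 k)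
    (fun i => vert k (g i)) (3 * k + 1) (by omega)
    (fun i hi j hj h => hg.inj i hi j hj (vert_injOn (hg.lt i hi) (hg.lt j hj) h))
    (fun i hi => (hg.arc i hi).elim (fun h => h.adj hk) fun h => (h.adj hk).symm)
    (hg.arc_close.adj hk)
  refine ⟨_, c, ?_, h0, hi⟩
  rw [SimpleGraph.Walk.isHamiltonianCycle_iff_isCycle_and_length_eq]
  refine ⟨hc, ?_⟩
  rw [hl, Fintype.card_sum, Fintype.card_fin, Fintype.card_fin]
  omega

/-- The tour through the vertices `u_j` in increasing order of `j` in which the position of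
`v_{2j}` modulo `3` is `s` and that of `u_j` is `3 - s`. -/
def tour (k s i : ℕ) : ℕ :=
  if i = 3 * k + 1 then 2 * k + 1
  else if i % 3 = 0 then 2 * (i / 3)
  else if i % 3 = s then 2 * (i / 3) + 1
  else 2 * k + 2 + i / 3

/-- The tour `tour k 1` with its first two vertices exchanged. -/
def tourSwapFirst (k i : ℕ) : ℕ :=
  tour k 1 (if i = 0 then 1 else if i = 1 then 0 else i)

/-- The tour `tour k 2` with the two vertices before `v_{2k+2}` exchanged. -/
def tourSwapLast (k i : ℕ) : ℕ :=
  tour k 2 (if i = 3 * k then 3 * k - 1 else if i = 3 * k - 1 then 3 * k else i)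

theorem tour_lt {s i : ℕ} (hi : i ≤ 3 * k + 1) : tour k s i < 3 * k + 2 := by
  unfold tour
  split_ifs <;> omega

theorem tour_inj {s i j : ℕ} (hs : s = 1 ∨ s = 2) (hi : i ≤ 3 * k + 1) (hj : j ≤ 3 * k + 1)
    (h : tour k s i = tour k s j) : i = j := by
  unfold tour at h
  split_ifs at h <;> omega

theorem tour_three_mul {s j : ℕ} : tour k s (3 * j) = 2 * j := by
  rw [tour, if_neg (by omega), if_pos (by omega)]
  omega

theorem tour_add {s j : ℕ} (hs : s = 1 ∨ s = 2) (hj : j < k) :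
    tour k s (3 * j + s) = 2 * j + 1 := by
  rw [tour, if_neg (by omega), if_neg (by omega), if_pos (by omega)]
  omega

theorem tour_add_sub {s j : ℕ} (hs : s = 1 ∨ s = 2) (hj : j < k) :
    tour k s (3 * j + (3 - s)) = 2 * k + 2 + j := by
  rw [tour, if_neg (by omega), if_neg (by omega), if_neg (by omega)]
  omega

theorem tour_last {s : ℕ} : tour k s (3 * k + 1) = 2 * k + 1 := if_pos rfl

theorem tourSwapLast_of_lt {i : ℕ} (hi : i < 3 * k - 1) : tourSwapLast k i = tour k 2 i := by
  rw [tourSwapLast, if_neg (by omega), if_neg (by omega)]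

theorem tourSwapLast_sub_one (hk : 2 ≤ k) : tourSwapLast k (3 * k - 1) = 2 * k := by
  rw [tourSwapLast, if_neg (by omega), if_pos rfl, tour_three_mul]

theorem tourSwapLast_three_mul (hk : 2 ≤ k) : tourSwapLast k (3 * k) = 2 * k - 1 := by
  rw [tourSwapLast, if_pos rfl, show 3 * k - 1 = 3 * (k - 1) + 2 by omega,
    tour_add (.inr rfl) (by omega)]
  omega

theorem tourSwapLast_last : tourSwapLast k (3 * k + 1) = 2 * k + 1 := by
  rw [tourSwapLast, if_neg (by omega), if_neg (by omega), tour_last]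

theorem isTour_tour {s : ℕ} (hs : s = 1 ∨ s = 2) : IsTour k (tour k s) where
  lt i hi := tour_lt hi
  inj i hi j hj h := tour_inj hs hi hj h
  arc i hi := by
    unfold tour Arc
    split_ifs <;> omega
  arc_close := by simp [tour, Arc]

theorem isTour_tourSwapFirst (hk : 2 ≤ k) : IsTour k (tourSwapFirst k) where
  lt i hi := tour_lt (by split_ifs <;> omega)
  inj i hi j hj h := by
    have := tour_inj (.inl rfl) (by split_ifs <;> omega) (by split_ifs <;> omega) h
    split_ifs at this <;> omega
  arc i hi := by
    rcases (by omega : i = 0 ∨ i = 1 ∨ 2 ≤ i) with rfl | rfl | h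
    · simp [tourSwapFirst, tour, Arc]
    · simp [tourSwapFirst, tour, Arc]
      omega
    · simpa [tourSwapFirst, show i ≠ 0 by omega, show i ≠ 1 by omega] using
        (isTour_tour (.inl rfl)).arc i hi
  arc_close := by
    simp [tourSwapFirst, tour, Arc]
    omega

theorem isTour_tourSwapLast (hk : 2 ≤ k) : IsTour k (tourSwapLast k) where
  lt i hi := tour_lt (by split_ifs <;> omega)
  inj i hi j hj h := by
    have := tour_inj (.inr rfl) (by split_ifs <;> omega) (by split_ifs <;> omega) h
    split_ifs at this <;> omega
  arc i hi := by
    rcases (by omega : i + 1 < 3 * k - 1 ∨ i = 3 * k - 2 ∨ i = 3 * k - 1 ∨ i = 3 * k) with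
      h | rfl | rfl | rfl
    · simpa [tourSwapLast, show i ≠ 3 * k by omega, show i ≠ 3 * k - 1 by omega,
        show i + 1 ≠ 3 * k by omega, show i + 1 ≠ 3 * k - 1 by omega] using
        (isTour_tour (.inr rfl)).arc i hi
    · rw [tourSwapLast_of_lt (by omega), show 3 * k - 2 + 1 = 3 * k - 1 by omega,
        tourSwapLast_sub_one hk, show 3 * k - 2 = 3 * (k - 1) + 1 by omega,
        tour_add_sub (s := 2) (.inr rfl) (by omega)]
      unfold Arc
      omega
    · rw [tourSwapLast_sub_one hk, show 3 * k - 1 + 1 = 3 * k by omega, tourSwapLast_three_mul hk]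
      unfold Arc
      omega
    · rw [tourSwapLast_three_mul hk, tourSwapLast_last]
      unfold Arc
      omega
  arc_close := by
    rw [tourSwapLast_last, tourSwapLast_of_lt (by omega)]
    simp [tour, Arc]

theorem exists_isHamiltonianCycle {x y : ℕ} (hk : 2 ≤ k) (h : Arc k x y) :
    ∃ (v : _) (c : (graphD2 k).Walk v v), c.IsHamiltonianCycle ∧
      s(vert k x, vert k y) ∈ c.edges := by
  have step : ∀ g, IsTour k g → ∀ i < 3 * k + 1,
      (g i = x ∧ g (i + 1) = y ∨ g i = y ∧ g (i + 1) = x) →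
      ∃ (v : _) (c : (graphD2 k).Walk v v), c.IsHamiltonianCycle ∧
        s(vert k x, vert k y) ∈ c.edges := by
    intro g hg i hi hxy
    obtain ⟨v, c, hc, -, he⟩ := hg.exists_isHamiltonianCycle hk
    refine ⟨v, c, hc, ?_⟩
    rcases hxy with ⟨rfl, rfl⟩ | ⟨rfl, rfl⟩
    · exact he i hi
    · rw [Sym2.eq_swap]
      exact he i hi
  have close : ∀ g, IsTour k g → g (3 * k + 1) = x → g 0 = y →
      ∃ (v : _) (c : (graphD2 k).Walk v v), c.IsHamiltonianCycle ∧
        s(vert k x, vert k y) ∈ c.edges := by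
    rintro g hg rfl rfl
    obtain ⟨v, c, hc, he, -⟩ := hg.exists_isHamiltonianCycle hk
    exact ⟨v, c, hc, he⟩
  unfold Arc at h
  rcases h with ⟨hx, rfl⟩ | ⟨rfl, rfl | rfl | rfl⟩ | ⟨hx, hx', hy, hy'⟩
  · rcases Nat.even_or_odd' x with ⟨j, rfl | rfl⟩
    · refine step _ (isTour_tour (s := 1) (.inl rfl)) (3 * j) (by omega)
        (.inl ⟨tour_three_mul, ?_⟩)
      rcases (by omega : j < k ∨ j = k) with hj | rfl
      · exact tour_add (.inl rfl) hj
      · exact tour_last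
    · exact step _ (isTour_tour (s := 2) (.inr rfl)) (3 * j + 2) (by omega)
        (.inl ⟨tour_add (.inr rfl) (by omega), tour_three_mul (j := j + 1)⟩)
  · exact close _ (isTour_tour (s := 1) (.inl rfl)) tour_last (tour_three_mul (j := 0))
  · refine close _ (isTour_tourSwapFirst hk) ?_ (tour_add (j := 0) (.inl rfl) (by omega))
    rw [tourSwapFirst, if_neg (by omega), if_neg (by omega), tour_last]
  · exact step _ (isTour_tourSwapLast hk) (3 * k) (by omega)
      (.inr ⟨tourSwapLast_three_mul hk, tourSwapLast_last⟩)
  · obtain ⟨j, rfl⟩ := Nat.exists_eq_add_of_le hx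
    rw [Nat.add_sub_cancel_left] at hy hy'
    have hj : j < k := by omega
    rcases (by omega : y = 2 * j ∨ y = 2 * j + 1 ∨ y = 2 * j + 2) with rfl | rfl | rfl
    · exact step _ (isTour_tour (s := 2) (.inr rfl)) (3 * j) (by omega)
        (.inr ⟨tour_three_mul, tour_add_sub (s := 2) (.inr rfl) hj⟩)
    · exact step _ (isTour_tour (s := 1) (.inl rfl)) (3 * j + 1) (by omega)
        (.inr ⟨tour_add (.inl rfl) hj, tour_add_sub (s := 1) (.inl rfl) hj⟩)
    · exact step _ (isTour_tour (s := 1) (.inl rfl)) (3 * j + 2) (by omega)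
        (.inl ⟨tour_add_sub (s := 1) (.inl rfl) hj, tour_three_mul (j := j + 1)⟩)

theorem edgeProper_three (hk : 2 ≤ k) : (graphD2 k).EdgeProper 3 := by
  intro e he
  obtain ⟨x, y, h, rfl⟩ := exists_arc_of_mem_edgeSet he
  refine ⟨fun i hi hi' => ?_, exists_isHamiltonianCycle hk h⟩
  obtain rfl : i = 3 := by omega
  exact edgeInCycleOfLength_three hk h

/-- An enumeration of the arcs by the numbers below `5 * k + 4`. -/
def arcAt (k e : ℕ) : ℕ × ℕ :=
  if e < 2 * k + 1 then (e, e + 1)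
  else if e = 2 * k + 1 then (2 * k + 1, 0)
  else if e = 2 * k + 2 then (2 * k + 1, 1)
  else if e = 2 * k + 3 then (2 * k + 1, 2 * k - 1)
  else (2 * k + 2 + (e - (2 * k + 4)) / 3, 2 * ((e - (2 * k + 4)) / 3) + (e - (2 * k + 4)) % 3)

theorem arc_arcAt {e : ℕ} (he : e < 5 * k + 4) : Arc k (arcAt k e).1 (arcAt k e).2 := by
  unfold arcAt Arc
  split_ifs <;> dsimp only <;> omega

theorem exists_arcAt_eq {x y : ℕ} (h : Arc k x y) : ∃ e < 5 * k + 4, arcAt k e = (x, y) := by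
  rcases h with ⟨hx, rfl⟩ | ⟨rfl, rfl | rfl | rfl⟩ | ⟨hx, hx', hy, hy'⟩
  · exact ⟨x, by omega, by simp [arcAt, hx]⟩
  · exact ⟨2 * k + 1, by omega, by simp [arcAt]⟩
  · exact ⟨2 * k + 2, by omega, by simp [arcAt]⟩
  · exact ⟨2 * k + 3, by omega, by simp [arcAt]⟩
  · refine ⟨2 * k + 4 + 3 * (x - (2 * k + 2)) + (y - 2 * (x - (2 * k + 2))), by omega, ?_⟩
    unfold arcAt
    split_ifs <;> rw [Prod.mk.injEq] <;> omega

theorem Arc.asymm {x y : ℕ} (hk : 2 ≤ k) (h : Arc k x y) : ¬ Arc k y x := by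
  unfold Arc at *
  omega

theorem arcAt_injective (hk : 2 ≤ k) : Function.Injective (arcAt k) := by
  intro e e' h
  unfold arcAt at h
  split_ifs at h <;> rw [Prod.mk.injEq] at h <;> omega

theorem edgeSet_ncard (hk : 2 ≤ k) : (graphD2 k).edgeSet.ncard = 5 * k + 4 := by
  have himg : (graphD2 k).edgeSet =
      (fun e => s(vert k (arcAt k e).1, vert k (arcAt k e).2)) '' Set.Iio (5 * k + 4) := by
    ext e
    constructor
    · intro he
      obtain ⟨x, y, h, rfl⟩ := exists_arc_of_mem_edgeSet he
      obtain ⟨i, hi, hxy⟩ := exists_arcAt_eq h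
      exact ⟨i, hi, by simp [hxy]⟩
    · rintro ⟨i, hi, rfl⟩
      exact (arc_arcAt hi).adj hk
  have lt : ∀ e < 5 * k + 4, (arcAt k e).1 < 3 * k + 2 ∧ (arcAt k e).2 < 3 * k + 2 := by
    intro e he
    have := (arc_arcAt he).lt
    omega
  rw [himg, Set.InjOn.ncard_image, Set.ncard_eq_toFinset_card']
  · simp
  · intro e he e' he' h
    rcases Sym2.eq_iff.1 h with ⟨h1, h2⟩ | ⟨h1, h2⟩
    · exact arcAt_injective hk (Prod.ext (vert_injOn (lt e he).1 (lt e' he').1 h1)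
        (vert_injOn (lt e he).2 (lt e' he').2 h2))
    · refine absurd (arc_arcAt he) (Arc.asymm hk ?_)
      rw [vert_injOn (lt e he).1 (lt e' he').2 h1, vert_injOn (lt e he).2 (lt e' he').1 h2]
      exact arc_arcAt he'

theorem graphD1_ne (hk : 2 ≤ k) : graphD1 k ≠ graphD2 k := by
  intro h
  have h1 : (graphD1 k).Adj (.inl ⟨2 * k, by omega⟩) (.inl ⟨0, by omega⟩) := by
    simp [graphD1]
    omega
  rw [h] at h1
  simp only [graphD2, SimpleGraph.fromRel_adj, succ_mod_eq_iff (show 2 * k < 2 * k + 1 + 1 by omega),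
    succ_mod_eq_iff (show 0 < 2 * k + 1 + 1 by omega)] at h1
  omega

end GraphD2

/-- for `k ≥ 2`, `D²_{3k+2}` is also a 3-edge-proper graph of order `3k + 2` with
exactly `5k + 4` edges; hence there are at least two non-identical extremal 3-edge-proper
graphs of order `3k + 2` attaining the bound `⌈5n/3⌉`. -/
theorem statement_10 (k : ℕ) (hk : 2 ≤ k) :
    Fintype.card (Fin (2 * k + 2) ⊕ Fin k) = 3 * k + 2 ∧
    (graphD2 k).EdgeProper 3 ∧
    (graphD2 k).edgeSet.ncard = 5 * k + 4 ∧
    ((graphD2 k).edgeSet.ncard : ℤ) = ⌈(5 * ((3 * k + 2 : ℕ) : ℚ)) / 3⌉ ∧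
    graphD1 k ≠ graphD2 k := by
  refine ⟨?_, GraphD2.edgeProper_three hk, GraphD2.edgeSet_ncard hk, ?_, GraphD2.graphD1_ne hk⟩
  · simp only [Fintype.card_sum, Fintype.card_fin]
    omega
  · rw [GraphD2.edgeSet_ncard hk, eq_comm, Int.ceil_eq_iff]
    push_cast
    constructor <;> linarith
end

section
/- Let t ≥ 3 be an integer and n = 4t. Let G be the graph of order n obtained from the cycle C_t = w_1 w_2 … w_t w_1 by replacing every edge w_i w_{i+1} with a copy of the fan graph F_5, identifying w_i with the path-endpoint v_1 and w_{i+1} with the path-endpoint v_4 of the fan. Then G is 4-edge-proper and e(G) = 7t = 7n/4; hence the lower bound e(G) ≥ ⌈7n/4⌉ for 4-edge-proper graphs is attained for all n divisible by 4 with n ≥ 12. -/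
/-- The graph of order `4t` obtained from a cycle `w_1 … w_t w_1` by replacing every edge
`w_i w_{i+1}` by an (internally disjoint) copy of the fan `F_5`, identifying `w_i` with the
path-endpoint `v_1` and `w_{i+1}` with the path-endpoint `v_4` of the fan.  Here the vertex
`(i, 0)` is `w_i` (the vertex `v_1` of the `i`-th fan), `(i, 1)` and `(i, 2)` are the internal
path vertices `v_2, v_3` of the `i`-th fan, `(i, 3)` is the hub `u` of the `i`-th fan, and
`v_4` of the `i`-th fan is `(i + 1, 0) = w_{i+1}`. -/
def fanCycle5 (t : ℕ) : SimpleGraph (Fin t × Fin 4) :=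
  SimpleGraph.fromRel (fun a b =>
    (a.1 = b.1 ∧ ((a.2.val = 0 ∧ b.2.val = 1) ∨ (a.2.val = 1 ∧ b.2.val = 2) ∨
      (a.2.val = 3 ∧ b.2.val ≠ 3))) ∨
    (b.1.val = (a.1.val + 1) % t ∧ b.2.val = 0 ∧ (a.2.val = 2 ∨ a.2.val = 3)))

namespace SimpleGraph

theorem cycleGraph.mk_add_one_mem_edges_cycle {n : ℕ} (i : Fin (n + 3)) :
    s(i, i + 1) ∈ (cycleGraph.cycle n).edges := by
  have h := (cycleGraph.cycle n).toSubgraph_adj_getVert (i := n + 2 - i) (by simp; omega)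
  rw [Walk.adj_toSubgraph_iff_mem_edges, cycleGraph.getVert_cycle (by omega),
    cycleGraph.getVert_cycle (by omega), Sym2.eq_swap] at h
  have h₁ : n + 3 - (n + 2 - i.val + 1) = i := by omega
  have h₂ : n + 3 - (n + 2 - i.val) = i + 1 := by omega
  convert h using 3
  · simp [h₁, Nat.mod_eq_of_lt i.isLt]
  · simp [h₂, Fin.val_add]

/-- A cyclic enumeration of all vertices with consecutive ones adjacent is a Hamiltonian cycle. -/
theorem exists_isHamiltonianCycle_of_injective {V : Type*} [Fintype V] [DecidableEq V]
    {G : SimpleGraph V} {n : ℕ} [NeZero n]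
    (hn : 3 ≤ n) (hV : Fintype.card V = n) (f : Fin n → V) (hf : Function.Injective f)
    (hadj : ∀ i, G.Adj (f i) (f (i + 1))) :
    ∃ (v : V) (c : G.Walk v v), c.IsHamiltonianCycle ∧ ∀ i, s(f i, f (i + 1)) ∈ c.edges := by
  obtain ⟨m, rfl⟩ : ∃ m, n = m + 3 := ⟨n - 3, by omega⟩
  let φ : cycleGraph (m + 3) →g G :=
    { toFun := f
      map_rel' := by
        intro a b hab
        rcases cycleGraph_adj.1 hab with h | h
        · rw [sub_eq_iff_eq_add'.1 h]
          exact (hadj b).symm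
        · rw [sub_eq_iff_eq_add'.1 h]
          exact hadj a }
  refine ⟨_, (cycleGraph.cycle m).map φ, Walk.isHamiltonianCycle_iff_isCycle_and_length_eq.2
    ⟨cycleGraph.isCycle_cycle.map hf, by simp [hV]⟩, fun i => ?_⟩
  rw [Walk.edges_map]
  exact List.mem_map.2 ⟨_, cycleGraph.mk_add_one_mem_edges_cycle i, rfl⟩

theorem exists_isCycle_length_three {V : Type*} {G : SimpleGraph V} {a b c : V}
    (hab : G.Adj a b) (hbc : G.Adj b c) (hca : G.Adj c a) :
    ∃ (v : V) (p : G.Walk v v), p.IsCycle ∧ p.length = 3 ∧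
      s(a, b) ∈ p.edges ∧ s(b, c) ∈ p.edges ∧ s(c, a) ∈ p.edges := by
  refine ⟨a, .cons hab (.cons hbc (.cons hca .nil)), ?_, rfl, by simp, by simp, by simp⟩
  have := hab.ne; have := hbc.ne; have := hca.ne
  simp [Walk.cons_isCycle_iff]
  grind

theorem exists_isCycle_length_four {V : Type*} {G : SimpleGraph V} {a b c d : V}
    (hab : G.Adj a b) (hbc : G.Adj b c) (hcd : G.Adj c d) (hda : G.Adj d a)
    (hac : a ≠ c) (hbd : b ≠ d) :
    ∃ (v : V) (p : G.Walk v v), p.IsCycle ∧ p.length = 4 ∧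
      s(a, b) ∈ p.edges ∧ s(b, c) ∈ p.edges ∧ s(c, d) ∈ p.edges ∧ s(d, a) ∈ p.edges := by
  refine ⟨a, .cons hab (.cons hbc (.cons hcd (.cons hda .nil))), ?_, rfl,
    by simp, by simp, by simp, by simp⟩
  have := hab.ne; have := hbc.ne; have := hcd.ne; have := hda.ne
  simp [Walk.cons_isCycle_iff]
  grind

end SimpleGraph

section FanCycle

open SimpleGraph

/-- The cyclic enumeration of the vertices of `fanCycle5 t` that visits every fan in the
order `σ`. -/
def fanTour {t : ℕ} (σ : Fin 4 → Fin 4) (k : Fin (t * 4)) : Fin t × Fin 4 :=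
  (k.divNat, σ k.modNat)

theorem fanTour_finProdFinEquiv {t : ℕ} (σ : Fin 4 → Fin 4) (i : Fin t) (j : Fin 4) :
    fanTour σ (finProdFinEquiv (i, j)) = (i, σ j) := by
  have h : ((finProdFinEquiv (i, j)).divNat, (finProdFinEquiv (i, j)).modNat) = (i, j) :=
    finProdFinEquiv.symm_apply_apply (i, j)
  rw [Prod.mk.injEq] at h
  rw [fanTour, h.1, h.2]

variable {t : ℕ} [NeZero t]

/-- The seven edges of the `i`-th fan of `fanCycle5 t`. -/
def fanEdge (i : Fin t) : Fin 7 → Sym2 (Fin t × Fin 4) :=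
  ![s((i, 0), (i, 1)), s((i, 1), (i, 2)), s((i, 2), (i + 1, 0)), s((i, 3), (i, 0)),
    s((i, 3), (i, 1)), s((i, 3), (i, 2)), s((i, 3), (i + 1, 0))]

theorem Fin.add_one_ne_self_of_two_le (ht : 2 ≤ t) (i : Fin t) : i + 1 ≠ i := by
  obtain ⟨m, rfl⟩ : ∃ m, t = m + 2 := ⟨t - 2, by omega⟩
  simp

theorem edgeSet_fanCycle5 :
    (fanCycle5 t).edgeSet = Set.range fun p : Fin t × Fin 7 => fanEdge p.1 p.2 := by
  have hs : ∀ i j : Fin t, j.val = (i.val + 1) % t ↔ j = i + 1 := fun i j => by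
    simp [Fin.ext_iff, Fin.val_add]
  ext e
  induction e with | _ a b
  obtain ⟨i, x⟩ := a
  obtain ⟨j, y⟩ := b
  simp only [mem_edgeSet, fanCycle5, fromRel_adj, hs, Set.mem_range, Prod.exists]
  constructor
  · rintro ⟨-, (⟨rfl, h⟩ | ⟨rfl, hz, h⟩) | (⟨rfl, h⟩ | ⟨rfl, hz, h⟩)⟩
    · refine ⟨i, ?_⟩
      fin_cases x <;> fin_cases y <;> simp [Fin.exists_fin_succ, fanEdge] at h ⊢
    · obtain rfl : y = 0 := Fin.ext hz
      refine ⟨i, ?_⟩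
      fin_cases x <;> simp [Fin.exists_fin_succ, fanEdge] at h ⊢
    · refine ⟨j, ?_⟩
      fin_cases x <;> fin_cases y <;> simp [Fin.exists_fin_succ, fanEdge] at h ⊢
    · obtain rfl : x = 0 := Fin.ext hz
      refine ⟨j, ?_⟩
      fin_cases y <;> simp [Fin.exists_fin_succ, fanEdge] at h ⊢
  · rintro ⟨l, k, h⟩
    fin_cases k <;> simp [fanEdge] at h <;>
      rcases h with ⟨⟨rfl, rfl⟩, rfl, rfl⟩ | ⟨⟨rfl, rfl⟩, rfl, rfl⟩ <;> simp

theorem fanEdge_injective (ht : 2 ≤ t) :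
    Function.Injective fun p : Fin t × Fin 7 => fanEdge p.1 p.2 := by
  have h := Fin.add_one_ne_self_of_two_le ht
  rintro ⟨i, j⟩ ⟨i', j'⟩ hij
  fin_cases j <;> fin_cases j' <;> simp [fanEdge] at hij ⊢ <;> grind

theorem finProdFinEquiv_add_one (i : Fin t) (j : Fin 4) :
    finProdFinEquiv (i, j) + 1 = if j = 3 then finProdFinEquiv (i + 1, 0)
      else finProdFinEquiv (i, j + 1) := by
  have ht := NeZero.pos t
  have hi := i.isLt
  ext
  rw [Fin.val_add, Fin.val_one', Nat.mod_eq_of_lt (show 1 < t * 4 by omega)]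
  rcases Nat.lt_or_ge (i.val + 1) t with h | h
  · have hs : (i + 1).val = i.val + 1 := by simp [Fin.val_add, Nat.mod_eq_of_lt h]
    rw [Nat.mod_eq_of_lt (by simp; omega)]
    fin_cases j <;> simp [hs] <;> omega
  · have hs : (i + 1).val = 0 := by simp [Fin.val_add, show i.val + 1 = t by omega]
    fin_cases j
    · simp; rw [Nat.mod_eq_of_lt (by omega)]; omega
    · simp; rw [Nat.mod_eq_of_lt (by omega)]; omega
    · simp; rw [Nat.mod_eq_of_lt (by omega)]; omega
    · simp [hs]; rw [show 3 + 4 * i.val + 1 = t * 4 by omega, Nat.mod_self]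

theorem exists_isHamiltonianCycle_fanCycle5 {σ : Fin 4 → Fin 4} (hσ : Function.Injective σ)
    (hσ0 : σ 0 = 0) (h01 : ∀ i : Fin t, (fanCycle5 t).Adj (i, σ 0) (i, σ 1))
    (h12 : ∀ i : Fin t, (fanCycle5 t).Adj (i, σ 1) (i, σ 2))
    (h23 : ∀ i : Fin t, (fanCycle5 t).Adj (i, σ 2) (i, σ 3))
    (h30 : ∀ i : Fin t, (fanCycle5 t).Adj (i, σ 3) (i + 1, 0)) :
    ∃ (v : _) (c : (fanCycle5 t).Walk v v), c.IsHamiltonianCycle ∧ ∀ i : Fin t,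
      s((i, σ 0), (i, σ 1)) ∈ c.edges ∧ s((i, σ 1), (i, σ 2)) ∈ c.edges ∧
      s((i, σ 2), (i, σ 3)) ∈ c.edges ∧ s((i, σ 3), (i + 1, 0)) ∈ c.edges := by
  have ht := NeZero.pos t
  obtain ⟨v, c, hc, he⟩ := exists_isHamiltonianCycle_of_injective (G := fanCycle5 t)
    (n := t * 4) (by omega) (by simp) (fanTour σ)
    (by
      intro a b
      obtain ⟨⟨i, x⟩, rfl⟩ := finProdFinEquiv.surjective a
      obtain ⟨⟨j, y⟩, rfl⟩ := finProdFinEquiv.surjective b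
      simp only [fanTour_finProdFinEquiv, Prod.mk.injEq, EmbeddingLike.apply_eq_iff_eq]
      exact fun h => ⟨h.1, hσ h.2⟩)
    (by
      intro a
      obtain ⟨⟨i, x⟩, rfl⟩ := finProdFinEquiv.surjective a
      rw [finProdFinEquiv_add_one]
      rw [hσ0] at h01
      fin_cases x <;> simp [fanTour_finProdFinEquiv, *])
  refine ⟨v, c, hc, fun i => ?_⟩
  have h := fun j => he (finProdFinEquiv (i, j))
  simp only [finProdFinEquiv_add_one] at h
  have h0 := h 0
  have h1 := h 1
  have h2 := h 2
  have h3 := h 3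
  simp [fanTour_finProdFinEquiv, hσ0] at h0 h1 h2 h3
  simp [hσ0, h0, h1, h2, h3]

theorem edgeProper_fanCycle5 (ht : 2 ≤ t) : (fanCycle5 t).EdgeProper 4 := by
  have hne := Fin.add_one_ne_self_of_two_le ht
  have hadj : ∀ i j, fanEdge i j ∈ (fanCycle5 t).edgeSet := fun i j => by
    rw [edgeSet_fanCycle5]; exact ⟨(i, j), rfl⟩
  have a01 : ∀ i : Fin t, (fanCycle5 t).Adj (i, 0) (i, 1) := fun i => hadj i 0
  have a12 : ∀ i : Fin t, (fanCycle5 t).Adj (i, 1) (i, 2) := fun i => hadj i 1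
  have a20 : ∀ i : Fin t, (fanCycle5 t).Adj (i, 2) (i + 1, 0) := fun i => hadj i 2
  have u0 : ∀ i : Fin t, (fanCycle5 t).Adj (i, 3) (i, 0) := fun i => hadj i 3
  have u1 : ∀ i : Fin t, (fanCycle5 t).Adj (i, 3) (i, 1) := fun i => hadj i 4
  have u2 : ∀ i : Fin t, (fanCycle5 t).Adj (i, 3) (i, 2) := fun i => hadj i 5
  have u3 : ∀ i : Fin t, (fanCycle5 t).Adj (i, 3) (i + 1, 0) := fun i => hadj i 6
  obtain ⟨_, c, hc, hce⟩ := exists_isHamiltonianCycle_fanCycle5 (t := t) (σ := ![0, 1, 2, 3])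
    (by decide) rfl a01 a12 (fun i => (u2 i).symm) u3
  obtain ⟨_, d, hd, hde⟩ := exists_isHamiltonianCycle_fanCycle5 (t := t) (σ := ![0, 3, 1, 2])
    (by decide) rfl (fun i => (u0 i).symm) u1 a12 a20
  intro e he
  rw [edgeSet_fanCycle5] at he
  obtain ⟨⟨i, j⟩, rfl⟩ := he
  obtain ⟨_, p, hp, hpl, hpe⟩ := exists_isCycle_length_three (u1 i) (a12 i) (u2 i).symm
  obtain ⟨_, q, hq, hql, hqe⟩ := exists_isCycle_length_three (u0 i) (a01 i) (u1 i).symm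
  obtain ⟨_, r, hr, hrl, hre⟩ := exists_isCycle_length_three (u2 i) (a20 i) (u3 i).symm
  obtain ⟨_, p', hp', hpl', hpe'⟩ := exists_isCycle_length_four (u0 i) (a01 i) (a12 i)
    (u2 i).symm (by simp) (by simp)
  obtain ⟨_, q', hq', hql', hqe'⟩ := exists_isCycle_length_four (u1 i) (a12 i) (a20 i)
    (u3 i).symm (by simp) (by simp)
  replace hce := hce i
  replace hde := hde i
  have e03 : s((i, (0 : Fin 4)), (i, 3)) = s((i, 3), (i, 0)) := Sym2.eq_swap
  have e13 : s((i, (1 : Fin 4)), (i, 3)) = s((i, 3), (i, 1)) := Sym2.eq_swap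
  have e23 : s((i, (2 : Fin 4)), (i, 3)) = s((i, 3), (i, 2)) := Sym2.eq_swap
  have e43 : s((i + 1, (0 : Fin 4)), (i, 3)) = s((i, 3), (i + 1, 0)) := Sym2.eq_swap
  simp only [Matrix.cons_val, e03, e13, e23, e43] at hce hde hpe hqe hre hpe' hqe'
  constructor
  · intro k hk3 hk4
    obtain rfl | rfl : k = 3 ∨ k = 4 := by omega
    · have key : fanEdge i j ∈ p.edges ∨ fanEdge i j ∈ q.edges ∨ fanEdge i j ∈ r.edges := by
        fin_cases j <;> simp [fanEdge, hpe, hqe, hre]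
      rcases key with h | h | h
      exacts [⟨_, p, hp, hpl, h⟩, ⟨_, q, hq, hql, h⟩, ⟨_, r, hr, hrl, h⟩]
    · have key : fanEdge i j ∈ p'.edges ∨ fanEdge i j ∈ q'.edges := by
        fin_cases j <;> simp [fanEdge, hpe', hqe']
      rcases key with h | h
      exacts [⟨_, p', hp', hpl', h⟩, ⟨_, q', hq', hql', h⟩]
  · have key : fanEdge i j ∈ c.edges ∨ fanEdge i j ∈ d.edges := by
      fin_cases j <;> simp [fanEdge, hce, hde]
    rcases key with h | h
    exacts [⟨_, c, hc, h⟩, ⟨_, d, hd, h⟩]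

theorem ncard_edgeSet_fanCycle5 (ht : 2 ≤ t) : (fanCycle5 t).edgeSet.ncard = 7 * t := by
  rw [edgeSet_fanCycle5, ← Set.image_univ, Set.ncard_image_of_injective _ (fanEdge_injective ht),
    Set.ncard_univ]
  simp [mul_comm]

end FanCycle

/-- for `t ≥ 3` and `n = 4t`, the graph obtained from `C_t` by replacing each
edge by a fan `F_5` is 4-edge-proper with `e(G) = 7t = 7n/4`; hence the bound `⌈7n/4⌉` for
4-edge-proper graphs is attained whenever `4 ∣ n` and `n ≥ 12`. -/
theorem statement_11 (t : ℕ) (ht : 3 ≤ t) :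
    Fintype.card (Fin t × Fin 4) = 4 * t ∧
    (fanCycle5 t).EdgeProper 4 ∧
    (fanCycle5 t).edgeSet.ncard = 7 * t ∧
    ((fanCycle5 t).edgeSet.ncard : ℤ) = ⌈(7 * ((4 * t : ℕ) : ℚ)) / 4⌉ := by
  have : NeZero t := ⟨by omega⟩
  have hcard := ncard_edgeSet_fanCycle5 (t := t) (by omega)
  refine ⟨by simp [mul_comm], edgeProper_fanCycle5 (by omega), hcard, ?_⟩
  have h : (7 * ((4 * t : ℕ) : ℚ)) / 4 = ((7 * t : ℕ) : ℤ) := by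
    push_cast
    ring
  rw [hcard, h, Int.ceil_intCast]
end
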